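/- arXiv:1203.4600 — 4 statements merged into one kernel-verified Lean document; each statement's English description precedes it below -/
import Mathlib

section
/- Let (P) ⊆ ℝ[x₁,…,x_d] be a principal prime ideal, P irreducible. Then (P) is real if and only if (P) = I(Z(P)), the ideal of all polynomials vanishing on the real zero set of P. -/
/-- An ideal `I ⊆ ℝ[x₁,…,x_d]` is *real* if whenever a finite sum of squares
`a₁² + ⋯ + a_ℓ²` belongs to `I`, each `a_j` belongs to `I`. -/
def IsRealIdeal {d : ℕ} (I : Ideal (MvPolynomial (Fin d) ℝ)) : Prop :=
  ∀ (ℓ : ℕ) (a : Fin ℓ → MvPolynomial (Fin d) ℝ),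
    (∑ j, a j ^ 2) ∈ I → ∀ j, a j ∈ I

section
open Polynomial

/-- The intermediate value property for sign changes of polynomials. -/
def PolynomialIVT (R : Type*) [Field R] [LinearOrder R] : Prop :=
  ∀ (f : R[X]) (a b : R), a < b → f.eval a * f.eval b < 0 → ∃ c, a < c ∧ c < b ∧ f.eval c = 0

theorem IsSumSq.map_ringHom {A B : Type*} [Semiring A] [Semiring B] (f : A →+* B) {s : A}
    (hs : IsSumSq s) : IsSumSq (f s) := by
  induction hs with
  | zero => simp
  | sq_add a _ ih => simpa using IsSumSq.sq_add (f a) ih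

/-- Every proper simple algebraic extension of `M` makes `-1` a sum of squares. -/
def IsMaximalReal (M : Type*) [Field M] : Prop :=
  ¬ IsSumSq (-1 : M) ∧
    ∀ q : M[X], Irreducible q → 1 < q.natDegree → IsSumSq (-1 : AdjoinRoot q)

theorem isSumSq_of_mem_sSup {K L : Type*} [Field K] [Field L] [Algebra K L]
    (c : Set (IntermediateField K L)) (hc : IsChain (· ≤ ·) c) (hne : c.Nonempty)
    (s : ↥(sSup c)) (hs : IsSumSq s) : ∃ F ∈ c, ∃ t : F, IsSumSq t ∧ (t : L) = s := by
  have : Nonempty c := hne.to_subtype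
  induction hs with
  | zero =>
    obtain ⟨F, hF⟩ := hne
    exact ⟨F, hF, 0, IsSumSq.zero, by simp⟩
  | sq_add a _ ih =>
    obtain ⟨F, hF, t, ht, hts⟩ := ih
    have ha : (a : L) ∈ ((⨆ i : c, (i : IntermediateField K L) : IntermediateField K L) : Set L) := by
      rw [← sSup_eq_iSup']
      exact a.2
    rw [IntermediateField.coe_iSup_of_directed hc.directed, Set.mem_iUnion] at ha
    obtain ⟨⟨G, hG⟩, haG⟩ := ha
    have key : ∃ H ∈ c, F ≤ H ∧ G ≤ H := by
      rcases hc.total hF hG with h | h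
      · exact ⟨G, hG, h, le_rfl⟩
      · exact ⟨F, hF, le_rfl, h⟩
    obtain ⟨H, hH, hFH, hGH⟩ := key
    refine ⟨H, hH, ⟨a, hGH haG⟩ * ⟨a, hGH haG⟩ + IntermediateField.inclusion hFH t, ?_, ?_⟩
    · exact IsSumSq.sq_add _ (ht.map_ringHom (IntermediateField.inclusion hFH : F →+* H))
    · simp [hts]

theorem exists_isMaximalReal (K : Type*) [Field K] (hK : ¬ IsSumSq (-1 : K)) :
    ∃ M : IntermediateField K (AlgebraicClosure K), IsMaximalReal M := by
  have hbot : ¬ IsSumSq (-1 : (⊥ : IntermediateField K (AlgebraicClosure K))) := fun h => hK <| by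
    simpa using h.map_ringHom
      (IntermediateField.botEquiv K (AlgebraicClosure K) : _ →+* K)
  obtain ⟨M, -, hM⟩ := zorn_le_nonempty₀
    {F : IntermediateField K (AlgebraicClosure K) | ¬ IsSumSq (-1 : F)} (by
      intro c hcs hc y hy
      refine ⟨sSup c, fun h => ?_, fun z hz => le_sSup hz⟩
      obtain ⟨F, hF, t, ht, hts⟩ := isSumSq_of_mem_sSup c hc ⟨y, hy⟩ _ h
      refine hcs hF ?_
      have : t = -1 := Subtype.ext (by simpa using hts)
      exact this ▸ ht) ⊥ hbot
  refine ⟨M, hM.prop, fun q hq hdeg => ?_⟩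
  have : Fact (Irreducible q) := ⟨hq⟩
  obtain ⟨α, hα⟩ := IsAlgClosed.exists_aeval_eq_zero (AlgebraicClosure K) q
    (by rw [degree_eq_natDegree hq.ne_zero]; exact_mod_cast (by omega))
  let g : AdjoinRoot q →ₐ[M] AlgebraicClosure K := AdjoinRoot.liftAlgHom q (Algebra.ofId _ _) α hα
  let N : IntermediateField K (AlgebraicClosure K) := g.fieldRange.restrictScalars K
  have hMN : M ≤ N := fun x hx => ⟨algebraMap M _ ⟨x, hx⟩, g.commutes ⟨x, hx⟩⟩
  have hαN : α ∈ N := ⟨AdjoinRoot.root q, AdjoinRoot.liftAlgHom_root q _ α hα⟩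
  have hN : IsSumSq (-1 : N) := by
    by_contra hcon
    have hαM : α ∈ M := hM.le_of_ge hcon hMN hαN
    have hroot : q.IsRoot ⟨α, hαM⟩ := by
      have : algebraMap M (AlgebraicClosure K) (q.eval ⟨α, hαM⟩) = 0 := by
        rw [← hα, ← Polynomial.aeval_algebraMap_apply_eq_algebraMap_eval]; rfl
      simpa using this
    have := Polynomial.degree_eq_one_of_irreducible_of_root hq hroot
    have : q.natDegree = 1 := natDegree_eq_of_degree_eq_some this
    omega
  let e : AdjoinRoot q ≃+* N :=
    RingEquiv.ofBijective g.toRingHom.rangeRestrictField g.toRingHom.rangeRestrictField_bijective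
  have := hN.map_ringHom (e.symm : N →+* AdjoinRoot q)
  simpa using this

section
variable {M : Type*} [Field M]

theorem exists_poly_of_isSumSq_adjoinRoot {q : M[X]} (hq : 0 < q.natDegree) (s : AdjoinRoot q)
    (hs : IsSumSq s) : ∃ G : M[X], AdjoinRoot.mk q G = s ∧ G.natDegree + 2 ≤ 2 * q.natDegree ∧
      ∀ r, IsSumSq (G.eval r) := by
  induction hs with
  | zero => exact ⟨0, by simp, by simp; omega, by simp⟩
  | sq_add a _ ih =>
    obtain ⟨G, hG, hd, hr⟩ := ih
    obtain ⟨b, rfl⟩ := AdjoinRoot.mk_surjective a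
    have hb : (b % q).natDegree < q.natDegree := natDegree_mod_lt b hq.ne'
    refine ⟨(b % q) * (b % q) + G, ?_, ?_, fun r => ?_⟩
    · have : AdjoinRoot.mk q (b % q) = AdjoinRoot.mk q b := by
        rw [AdjoinRoot.mk_eq_mk]
        exact ⟨-(b / q), by linear_combination EuclideanDomain.div_add_mod b q⟩
      simp [this, hG]
    · have h1 := natDegree_add_le ((b % q) * (b % q)) G
      have h2 := natDegree_mul_le (p := b % q) (q := b % q)
      omega
    · simpa using IsSumSq.sq_add _ (hr r)

theorem exists_of_isSumSq_adjoinRoot_sqrt (a : M) (s : AdjoinRoot (X ^ 2 - C a)) (hs : IsSumSq s) :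
    ∃ S T B : M, IsSumSq S ∧ IsSumSq T ∧
      s = AdjoinRoot.mk _ (C (S + a * T) + C B * X) := by
  induction hs with
  | zero => exact ⟨0, 0, 0, .zero, .zero, by simp⟩
  | sq_add b _ ih =>
    obtain ⟨S, T, B, hS, hT, rfl⟩ := ih
    obtain ⟨b, rfl⟩ := AdjoinRoot.mk_surjective b
    have hm : (X ^ 2 - C a).Monic := monic_X_pow_sub_C a two_ne_zero
    have hb : (b %ₘ (X ^ 2 - C a)).natDegree < 2 := by
      have := natDegree_modByMonic_lt b hm (by
        intro h; simpa using congrArg natDegree h)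
      simpa using this
    obtain ⟨u, v, huv⟩ := exists_eq_X_add_C_of_natDegree_le_one (Nat.lt_succ_iff.mp hb)
    refine ⟨v * v + S, u * u + T, 2 * u * v + B, .sq_add _ hS, .sq_add _ hT, ?_⟩
    rw [← map_mul, ← map_add, AdjoinRoot.mk_eq_mk]
    have h := modByMonic_add_div b (X ^ 2 - C a)
    rw [huv] at h
    rw [← h]
    simp only [map_add, map_mul, map_ofNat]
    refine ⟨(b /ₘ (X ^ 2 - C a)) * (2 * (C u * X + C v) + (X ^ 2 - C a) * (b /ₘ (X ^ 2 - C a))) + C u * C u, ?_⟩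
    ring

theorem IsMaximalReal.exists_isSumSq (hM : IsMaximalReal M) {a : M} (ha : ¬ IsSquare a) :
    ∃ S T : M, IsSumSq S ∧ IsSumSq T ∧ 1 + S + a * T = 0 := by
  have hdeg : (X ^ 2 - C a).natDegree = 2 := by simp
  have hirr : Irreducible (X ^ 2 - C a) := by
    rw [Polynomial.irreducible_iff_roots_eq_zero_of_degree_le_three (by omega) (by omega),
      Multiset.eq_zero_iff_forall_notMem]
    intro r hr
    have := (mem_roots'.mp hr).2
    refine ha ⟨r, ?_⟩
    simp only [IsRoot.def, eval_sub, eval_pow, eval_X, eval_C] at this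
    linear_combination -this
  obtain ⟨S, T, B, hS, hT, h⟩ := exists_of_isSumSq_adjoinRoot_sqrt a _ (hM.2 _ hirr (by omega))
  refine ⟨S, T, hS, hT, ?_⟩
  have h2 : AdjoinRoot.mk (X ^ 2 - C a) (C (1 + S + a * T) + C B * X) = 0 := by
    rw [show C (1 + S + a * T) + C B * X = 1 + (C (S + a * T) + C B * X) by
      simp only [map_add, map_one]; ring, map_add, ← h]
    simp
  rw [AdjoinRoot.mk_eq_zero] at h2
  have h3 : C (1 + S + a * T) + C B * X = 0 := by
    refine eq_zero_of_dvd_of_natDegree_lt h2 ?_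
    rw [hdeg]
    have := natDegree_linear_le (a := B) (b := 1 + S + a * T)
    rw [add_comm] at this
    omega
  simpa using congrArg (eval 0) h3

theorem eq_zero_of_isSumSq_neg (hM : ¬ IsSumSq (-1 : M)) {s : M} (h₁ : IsSumSq s)
    (h₂ : IsSumSq (-s)) : s = 0 := by
  by_contra hs
  refine hM ?_
  have : (-1 : M) = s * -s * (s⁻¹ * s⁻¹) := by field_simp
  rw [this]
  exact (h₁.mul h₂).mul (.mul_self _)

theorem IsMaximalReal.isSquare_or (hM : IsMaximalReal M) (a : M) :
    IsSquare a ∨ IsSquare (-a) := by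
  by_contra! h
  obtain ⟨S, T, hS, hT, h₁⟩ := hM.exists_isSumSq h.1
  obtain ⟨S', T', hS', hT', h₂⟩ := hM.exists_isSumSq h.2
  have hT0 : T ≠ 0 := by
    rintro rfl
    refine hM.1 ?_
    rwa [show (-1 : M) = S by linear_combination -h₁]
  have hna : IsSumSq (-a) := by
    have : -a = (1 + S) * T * (T⁻¹ * T⁻¹) := by
      field_simp
      linear_combination -h₁
    rw [this]
    exact ((IsSumSq.one.add hS).mul hT).mul (.mul_self _)
  refine hM.1 ?_
  rw [show (-1 : M) = S' + (-a) * T' by linear_combination -h₂]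
  exact hS'.add (hna.mul hT')

theorem IsMaximalReal.exists_order (hM : IsMaximalReal M) :
    ∃ (_ : LinearOrder M), IsStrictOrderedRing M ∧ ∀ a : M, 0 ≤ a ↔ IsSumSq a := by
  let C : RingCone M :=
    { carrier := {a | IsSumSq a}
      mul_mem' := IsSumSq.mul
      one_mem' := .one
      add_mem' := IsSumSq.add
      zero_mem' := .zero
      eq_zero_of_mem_of_neg_mem' := fun h₁ h₂ => eq_zero_of_isSumSq_neg hM.1 h₁ h₂ }
  have : HasMemOrNegMem C :=
    ⟨fun a => (hM.isSquare_or a).imp (fun h => h.isSumSq) (fun h => h.isSumSq)⟩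
  classical
  let o : LinearOrder M := LinearOrder.mkOfAddGroupCone C
  have h1 : IsOrderedRing M := IsOrderedRing.mkOfCone C
  refine ⟨o, inferInstance, fun a => ?_⟩
  change a - 0 ∈ C ↔ _
  rw [sub_zero]
  rfl

theorem IsMaximalReal.polynomialIVT (hM : IsMaximalReal M) [LinearOrder M] [IsStrictOrderedRing M] :
    PolynomialIVT M := by
  have main : ∀ n (f : M[X]), f.natDegree = n → ∀ a b : M, a < b → f.eval a * f.eval b < 0 →
      ∃ c, a < c ∧ c < b ∧ f.eval c = 0 := by
    intro n
    induction n using Nat.strong_induction_on with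
    | _ n ih =>
    intro f hf a b hab hfab
    have hf0 : f ≠ 0 := by rintro rfl; simp at hfab
    have hu : ¬ IsUnit f := by
      intro hu
      obtain ⟨r, -, rfl⟩ := Polynomial.isUnit_iff.mp hu
      simp only [eval_C] at hfab
      nlinarith [mul_self_nonneg r]
    by_cases hirr : Irreducible f
    · have hpos : 0 < f.natDegree := hirr.natDegree_pos
      by_cases h1 : f.natDegree = 1
      · obtain ⟨u, v, rfl⟩ := exists_eq_X_add_C_of_natDegree_le_one h1.le
        have hu0 : u ≠ 0 := by rintro rfl; simp at h1
        simp only [eval_add, eval_mul, eval_C, eval_X] at hfab ⊢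
        have hroot : u * (-v / u) + v = 0 := by field_simp; ring
        have e1 : (a - -v / u) * (b - -v / u) * (u * u) < 0 := by
          have : (a - -v / u) * (b - -v / u) * (u * u) = (u * a + v) * (u * b + v) := by
            field_simp; ring
          rwa [this]
        have e2 : (a - -v / u) * (b - -v / u) < 0 := by
          have : 0 < u * u := mul_self_pos.mpr hu0
          by_contra hcon
          push Not at hcon
          nlinarith
        refine ⟨-v / u, ?_, ?_, hroot⟩ <;> nlinarith
      · exfalso
        obtain ⟨G, hG, hd, hr⟩ := exists_poly_of_isSumSq_adjoinRoot hpos _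
          (hM.2 f hirr (by omega))
        have : AdjoinRoot.mk f (G + 1) = 0 := by simp [hG]
        rw [AdjoinRoot.mk_eq_zero] at this
        obtain ⟨h, hh⟩ := this
        have hev : ∀ r, 0 < f.eval r * h.eval r := by
          intro r
          rw [← eval_mul, ← hh]
          simp only [eval_add, eval_one]
          linarith [(hr r).nonneg]
        have hh0 : h ≠ 0 := by rintro rfl; simpa using hev 0
        have hdeg : h.natDegree < n := by
          have h1 := natDegree_mul hf0 hh0
          rw [← hh] at h1
          have h2 := natDegree_add_le G 1
          simp at h2
          omega
        have hsign : h.eval a * h.eval b < 0 := by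
          have := mul_pos (hev a) (hev b)
          by_contra hcon
          push Not at hcon
          nlinarith
        obtain ⟨c, -, -, hc⟩ := ih _ hdeg h rfl a b hab hsign
        have := hev c
        simp [hc] at this
    · rw [irreducible_iff] at hirr
      push Not at hirr
      obtain ⟨u, v, huv, hnu, hnv⟩ := hirr hu
      have hu0 : u ≠ 0 := by rintro rfl; simp at huv; exact hf0 huv
      have hv0 : v ≠ 0 := by rintro rfl; simp at huv; exact hf0 huv
      have hdu : 0 < u.natDegree := by
        rw [Nat.pos_iff_ne_zero]
        intro h0
        exact hnu (isUnit_iff_degree_eq_zero.mpr (by rw [degree_eq_natDegree hu0, h0]; rfl))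
      have hdv : 0 < v.natDegree := by
        rw [Nat.pos_iff_ne_zero]
        intro h0
        exact hnv (isUnit_iff_degree_eq_zero.mpr (by rw [degree_eq_natDegree hv0, h0]; rfl))
      have hd := natDegree_mul hu0 hv0
      rw [← huv] at hd
      rw [huv] at hfab
      simp only [eval_mul] at hfab
      have : u.eval a * u.eval b < 0 ∨ v.eval a * v.eval b < 0 := by
        by_contra! hcon
        nlinarith [mul_nonneg hcon.1 hcon.2]
      rcases this with h | h
      · obtain ⟨c, h1, h2, h3⟩ := ih _ (by omega) u rfl a b hab h
        exact ⟨c, h1, h2, by simp [huv, h3]⟩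
      · obtain ⟨c, h1, h2, h3⟩ := ih _ (by omega) v rfl a b hab h
        exact ⟨c, h1, h2, by simp [huv, h3]⟩
  exact fun f a b => main _ f rfl a b
end

section PolynomialIVT
variable {R : Type*} [Field R] [LinearOrder R] [IsStrictOrderedRing R]

theorem PolynomialIVT.mul_pos_of_forall_ne (hR : PolynomialIVT R) {f : R[X]} {a b : R} (hab : a ≤ b)
    (h : ∀ x, a ≤ x → x ≤ b → f.eval x ≠ 0) : 0 < f.eval a * f.eval b := by
  rcases hab.eq_or_lt with rfl | hlt
  · exact mul_self_pos.mpr (h a le_rfl le_rfl)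
  by_contra hcon
  have hne := mul_ne_zero (h a le_rfl hab) (h b hab le_rfl)
  obtain ⟨c, h1, h2, h3⟩ := hR f a b hlt (lt_of_le_of_ne (not_lt.mp hcon) hne)
  exact h c h1.le h2.le h3

theorem PolynomialIVT.exists_derivative_eq_zero (hR : PolynomialIVT R) {f : R[X]} {a b : R}
    (hab : a < b) (ha : f.eval a = 0) (hb : f.eval b = 0) :
    ∃ x, a < x ∧ x < b ∧ f.derivative.eval x = 0 := by
  classical
  by_cases hf : f = 0
  · obtain ⟨x, h1, h2⟩ := exists_between hab
    exact ⟨x, h1, h2, by simp [hf]⟩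
  have hne : (f.roots.toFinset.filter (a < ·)).Nonempty := ⟨b, by simp [hf, hb, hab]⟩
  obtain ⟨d, hd, hmin⟩ := Finset.exists_min_image _ id hne
  simp only [Finset.mem_filter, Multiset.mem_toFinset, mem_roots', IsRoot.def, id, and_imp]
    at hd hmin
  obtain ⟨⟨-, hd0⟩, had⟩ := hd
  have hdb : d ≤ b := hmin b hf hb hab
  obtain ⟨g, hg, hga⟩ := exists_eq_pow_rootMultiplicity_mul_and_not_dvd f hf a
  have hm : 0 < f.rootMultiplicity a := (rootMultiplicity_pos hf).mpr ha
  obtain ⟨m, hm⟩ := Nat.exists_eq_succ_of_ne_zero hm.ne'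
  rw [hm] at hg
  have hg0 : g ≠ 0 := by rintro rfl; simp at hga
  have hgd : g.eval d = 0 := by
    rw [hg] at hd0
    simpa [sub_ne_zero.mpr had.ne'] using hd0
  obtain ⟨h, hh, hhd⟩ := exists_eq_pow_rootMultiplicity_mul_and_not_dvd g hg0 d
  have hn : 0 < g.rootMultiplicity d := (rootMultiplicity_pos hg0).mpr hgd
  obtain ⟨n, hn⟩ := Nat.exists_eq_succ_of_ne_zero hn.ne'
  rw [hn] at hh
  have hha : h.eval a ≠ 0 := by
    intro h0
    refine hga (dvd_iff_isRoot.mpr ?_)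
    rw [IsRoot.def, hh, eval_mul, h0, mul_zero]
  have hhd' : h.eval d ≠ 0 := fun h0 => hhd (dvd_iff_isRoot.mpr h0)
  have hpos : 0 < h.eval a * h.eval d := by
    refine hR.mul_pos_of_forall_ne had.le fun x hx1 hx2 hx => ?_
    rcases hx1.eq_or_lt with rfl | hx1
    · exact hha hx
    rcases hx2.eq_or_lt with rfl | hx2
    · exact hhd' hx
    refine absurd (hmin x hf ?_ hx1) (not_le.mpr hx2)
    rw [hg, hh]
    simp [hx]
  let k : R[X] := (m + 1 : R[X]) * (X - C d) * h + (n + 1 : R[X]) * (X - C a) * h +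
    (X - C a) * (X - C d) * derivative h
  have hk : f.derivative = (X - C a) ^ m * (X - C d) ^ n * k := by
    rw [hg, hh]
    simp only [derivative_mul, derivative_pow, derivative_sub, derivative_X, derivative_C,
      Nat.succ_eq_add_one, Nat.cast_add, Nat.cast_one, add_tsub_cancel_right, k, map_add, map_one,
      map_natCast]
    ring
  have hkk : k.eval a * k.eval d < 0 := by
    have e : k.eval a * k.eval d =
        -((m + 1 : R) * (n + 1 : R) * ((a - d) ^ 2) * (h.eval a * h.eval d)) := by
      simp [k]
      ring
    rw [e, neg_lt_zero]
    have : a - d ≠ 0 := sub_ne_zero.mpr had.ne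
    positivity
  obtain ⟨c, h1, h2, h3⟩ := hR k a d had hkk
  exact ⟨c, h1, h2.trans_le hdb, by simp [hk, h3]⟩

theorem PolynomialIVT.exists_derivative_eq_slope (hR : PolynomialIVT R) (f : R[X]) {a b : R}
    (hab : a < b) :
    ∃ x, a < x ∧ x < b ∧ f.eval b - f.eval a = f.derivative.eval x * (b - a) := by
  obtain ⟨x, h1, h2, h3⟩ := hR.exists_derivative_eq_zero
    (f := C (b - a) * (f - C (f.eval a)) - C (f.eval b - f.eval a) * (X - C a)) hab
    (by simp) (by simp; ring)
  refine ⟨x, h1, h2, ?_⟩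
  simp at h3
  linear_combination -h3

theorem exists_forall_le_eval {f : R[X]} (hd : 0 < f.natDegree) (hl : 0 < f.leadingCoeff) (K : R) :
    ∃ M, ∀ x, M ≤ x → K ≤ f.eval x := by
  induction hn : f.natDegree generalizing f K with
  | zero => omega
  | succ n ih =>
    have hdn := natDegree_divX_eq_natDegree_tsub_one (p := f)
    have hln : f.divX.leadingCoeff = f.leadingCoeff := by
      rw [leadingCoeff, hdn, coeff_divX, Nat.sub_add_cancel hd, leadingCoeff]
    have hev : ∀ x, f.eval x = f.divX.eval x * x + f.coeff 0 := fun x => by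
      conv_lhs => rw [← divX_mul_X_add f]
      simp
    rcases Nat.eq_zero_or_pos n with rfl | hpos
    · have hc : f.divX = C f.leadingCoeff := by
        rw [← hln]
        exact eq_C_of_natDegree_le_zero (by omega) |>.trans (by rw [leadingCoeff]; congr 2; omega)
      refine ⟨(K - f.coeff 0) / f.leadingCoeff, fun x hx => ?_⟩
      rw [hev, hc, eval_C]
      rw [div_le_iff₀ hl] at hx
      linarith
    · obtain ⟨M, hM⟩ := ih (f := f.divX) (by omega) (by rwa [hln]) 1 (by omega)
      refine ⟨max M (max 0 (K - f.coeff 0)), fun x hx => ?_⟩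
      simp only [max_le_iff] at hx
      rw [hev]
      nlinarith [hM x hx.1]

theorem PolynomialIVT.exists_pos_of_derivative_pos (hR : PolynomialIVT R) {f : R[X]} {c : R}
    (h : ∀ x, c < x → 0 < f.derivative.eval x) : ∃ x, c < x ∧ 0 < f.eval x := by
  have hd : 0 < f.natDegree := by
    rw [Nat.pos_iff_ne_zero]
    intro h0
    have := h (c + 1) (by simp)
    rw [eq_C_of_natDegree_eq_zero h0] at this
    simp at this
  have hf0 : f ≠ 0 := by rintro rfl; simp at hd
  rcases lt_or_gt_of_ne (leadingCoeff_ne_zero.mpr hf0) with hl | hl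
  · exfalso
    obtain ⟨M, hM⟩ := exists_forall_le_eval (f := -f) (by simpa) (by simpa) (-f.eval c + 1)
    have hx := hM (max M (c + 1)) (le_max_left _ _)
    have hc : c < max M (c + 1) := lt_of_lt_of_le (by simp) (le_max_right _ _)
    obtain ⟨y, hy, -, hfy⟩ := hR.exists_derivative_eq_slope f hc
    have := mul_pos (h y hy) (sub_pos.mpr hc)
    simp only [eval_neg] at hx
    linarith
  · obtain ⟨M, hM⟩ := exists_forall_le_eval hd hl 1
    refine ⟨max M (c + 1), lt_of_lt_of_le (by simp) (le_max_right _ _), ?_⟩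
    linarith [hM _ (le_max_left M (c + 1))]

end PolynomialIVT

section SignMatching
variable {R S : Type*}

/-- Two elements have the same sign. -/
def SameSign [Zero R] [LT R] [Zero S] [LT S] (x : R) (y : S) : Prop :=
  (0 < x ↔ 0 < y) ∧ (x < 0 ↔ y < 0)

/-- The points `c` and `d` are in the same position relative to the pairs in `E`. -/
def SameCut [LT R] [LT S] (E : Set (R × S)) (c : R) (d : S) : Prop :=
  ∀ e ∈ E, (e.1 < c ↔ e.2 < d) ∧ (c < e.1 ↔ d < e.2)

theorem SameSign.symm [Zero R] [LT R] [Zero S] [LT S] {x : R} {y : S} (h : SameSign x y) :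
    SameSign y x := ⟨h.1.symm, h.2.symm⟩

theorem SameCut.swap [LT R] [LT S] {E : Set (R × S)} {c : R} {d : S} (h : SameCut E c d) :
    SameCut (Prod.swap ⁻¹' E) d c := fun _ he => ⟨(h _ he).1.symm, (h _ he).2.symm⟩

theorem SameCut.mono [LT R] [LT S] {E F : Set (R × S)} (hEF : E ⊆ F) {c : R} {d : S}
    (h : SameCut F c d) : SameCut E c d := fun e he => h e (hEF he)

theorem SameSign.eq_zero_iff [Zero R] [LinearOrder R] [Zero S] [LinearOrder S] {x : R} {y : S}
    (h : SameSign x y) : x = 0 ↔ y = 0 := by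
  have h1 := h.1
  have h2 := h.2
  constructor <;> rintro rfl
  · simp only [lt_self_iff_false, false_iff, not_lt] at h1 h2
    exact le_antisymm h1 h2
  · simp only [lt_self_iff_false, iff_false, not_lt] at h1 h2
    exact le_antisymm h1 h2

theorem SameSign.neg [AddCommGroup R] [LinearOrder R] [IsOrderedAddMonoid R]
    [AddCommGroup S] [LinearOrder S] [IsOrderedAddMonoid S] {x : R} {y : S}
    (h : SameSign x y) : SameSign (-x) (-y) := by
  simpa [SameSign] using And.intro h.2 h.1

theorem SameCut.neg [AddCommGroup R] [LinearOrder R] [IsOrderedAddMonoid R]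
    [AddCommGroup S] [LinearOrder S] [IsOrderedAddMonoid S] {E : Set (R × S)} {c : R} {d : S}
    (h : SameCut E c d) : SameCut ((fun e => -e) ⁻¹' E) (-c) (-d) := fun e he => by
  have := h (-e) he
  simp only [Prod.fst_neg, Prod.snd_neg] at this
  exact ⟨by rw [lt_neg, this.2, lt_neg], by rw [neg_lt, this.1, neg_lt]⟩

theorem SameCut.of_neg [AddCommGroup R] [LinearOrder R] [IsOrderedAddMonoid R]
    [AddCommGroup S] [LinearOrder S] [IsOrderedAddMonoid S] {E : Set (R × S)} {c : R} {d : S}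
    (h : SameCut ((fun e => -e) ⁻¹' E) c d) : SameCut E (-c) (-d) := by
  simpa [Set.preimage_preimage] using h.neg

theorem eval_derivative_comp_neg [CommRing R] (f : R[X]) (a : R) :
    (derivative (f.comp (-X))).eval a = -(derivative f).eval (-a) := by
  simp [derivative_comp]

theorem SameCut.eq_iff [LinearOrder R] [LinearOrder S] {E : Set (R × S)} {c : R} {d : S}
    (h : SameCut E c d) {e : R × S} (he : e ∈ E) : c = e.1 ↔ d = e.2 := by
  have h1 := (h e he).1
  have h2 := (h e he).2
  constructor <;> intro h3 <;> subst h3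
  · simp only [lt_self_iff_false, false_iff, not_lt] at h1 h2
    exact le_antisymm h1 h2
  · simp only [lt_self_iff_false, iff_false, not_lt] at h1 h2
    exact le_antisymm h1 h2

theorem exists_sameCut [LinearOrder R] [LinearOrder S] [DenselyOrdered S] [NoMinOrder S]
    [NoMaxOrder S] [Nonempty S] {E : Set (R × S)} (hE : E.Finite)
    (hs : ∀ e ∈ E, SameCut E e.1 e.2) (c : R) : ∃ d, SameCut E c d := by
  classical
  by_cases hc : ∃ e ∈ E, e.1 = c
  · obtain ⟨e, he, rfl⟩ := hc
    exact ⟨e.2, hs e he⟩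
  push Not at hc
  obtain ⟨d, hd1, hd2⟩ := Order.exists_between_finsets
    ((hE.toFinset.filter (fun e => e.1 < c)).image Prod.snd)
    ((hE.toFinset.filter (fun e => c < e.1)).image Prod.snd) (by
      intro x hx y hy
      simp only [Finset.mem_image, Finset.mem_filter, Set.Finite.mem_toFinset] at hx hy
      obtain ⟨e, ⟨he, hec⟩, rfl⟩ := hx
      obtain ⟨e', ⟨he', hec'⟩, rfl⟩ := hy
      exact (hs e he e' he').2.mp (hec.trans hec'))
  have hlo : ∀ e ∈ E, e.1 < c → e.2 < d := fun e he h => hd1 _ (by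
    simp only [Finset.mem_image, Finset.mem_filter, Set.Finite.mem_toFinset]
    exact ⟨e, ⟨he, h⟩, rfl⟩)
  have hhi : ∀ e ∈ E, c < e.1 → d < e.2 := fun e he h => hd2 _ (by
    simp only [Finset.mem_image, Finset.mem_filter, Set.Finite.mem_toFinset]
    exact ⟨e, ⟨he, h⟩, rfl⟩)
  refine ⟨d, fun e he => ?_⟩
  rcases lt_or_gt_of_ne (hc e he) with h | h
  · have := hlo e he h
    simp [h, this, h.not_gt, this.not_gt]
  · have := hhi e he h
    simp [h, this, h.not_gt, this.not_gt]

variable [Field R] [LinearOrder R] [Field S] [LinearOrder S]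

/-- `E` matches the critical points of `f` with those of `g`, compatibly with all signs. -/
structure CriticalMatching (f : R[X]) (g : S[X]) (E : Set (R × S)) : Prop where
  finite : E.Finite
  same : ∀ e ∈ E, SameCut E e.1 e.2
  sign_derivative : ∀ c d, SameCut E c d → SameSign (f.derivative.eval c) (g.derivative.eval d)
  left : ∀ a, f.derivative.eval a = 0 → ∃ e ∈ E, e.1 = a
  right : ∀ b, g.derivative.eval b = 0 → ∃ e ∈ E, e.2 = b
  sign : ∀ e ∈ E, SameSign (f.eval e.1) (g.eval e.2)

namespace CriticalMatching
variable {f : R[X]} {g : S[X]} {E : Set (R × S)}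

theorem swap (H : CriticalMatching f g E) : CriticalMatching g f (Prod.swap ⁻¹' E) where
  finite := H.finite.preimage Prod.swap_injective.injOn
  same e he := (H.same _ he).swap
  sign_derivative c d h := (H.sign_derivative d c h.swap).symm
  left a ha := by
    obtain ⟨e, he, h⟩ := H.right a ha
    exact ⟨e.swap, by simpa, h⟩
  right a ha := by
    obtain ⟨e, he, h⟩ := H.left a ha
    exact ⟨e.swap, by simpa, h⟩
  sign e he := (H.sign _ he).symm

/-- The matching obtained from `E` by adding the roots of `f` and `g`. -/
def _root_.addRoots (f : R[X]) (g : S[X]) (E : Set (R × S)) : Set (R × S) :=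
  E ∪ {e | f.eval e.1 = 0 ∧ g.eval e.2 = 0 ∧ SameCut E e.1 e.2}

theorem finite_addRoots (H : CriticalMatching f g E) (hf : f ≠ 0) (hg : g ≠ 0) :
    (addRoots f g E).Finite := by
  classical
  refine H.finite.union ((f.roots.toFinset ×ˢ g.roots.toFinset).finite_toSet.subset ?_)
  rintro e ⟨h1, h2, -⟩
  simp [hf, hg, h1, h2]

theorem _root_.addRoots_swap : addRoots g f (Prod.swap ⁻¹' E) = Prod.swap ⁻¹' addRoots f g E := by
  ext e
  have : SameCut (Prod.swap ⁻¹' E) e.1 e.2 ↔ SameCut E e.2 e.1 := ⟨fun h => h.swap, fun h => h.swap⟩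
  simp only [addRoots, Set.mem_union, Set.mem_preimage, Set.mem_ofPred_eq, this, Prod.fst_swap,
    Prod.snd_swap]
  tauto

theorem lt_of_roots_lt [IsStrictOrderedRing R] (H : CriticalMatching f g E) (hR : PolynomialIVT R)
    {a a' : R} {b b' : S} (ha : f.eval a = 0) (ha' : f.eval a' = 0) (hab : SameCut E a b)
    (hab' : SameCut E a' b') (h : a < a') : b < b' := by
  obtain ⟨x, hx1, hx2, hx⟩ := hR.exists_derivative_eq_zero h ha ha'
  obtain ⟨e, he, rfl⟩ := H.left x hx
  exact ((hab e he).2.mp hx1).trans ((hab' e he).1.mp hx2)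

variable [IsStrictOrderedRing R] [IsStrictOrderedRing S]

theorem neg (H : CriticalMatching f g E) : CriticalMatching (-f) (-g) E where
  finite := H.finite
  same := H.same
  sign_derivative c d h := by simpa using (H.sign_derivative c d h).neg
  left a ha := H.left a (by simpa using ha)
  right a ha := H.right a (by simpa using ha)
  sign e he := by simpa using (H.sign e he).neg

theorem reflect (H : CriticalMatching f g E) :
    CriticalMatching (f.comp (-X)) (g.comp (-X)) ((fun e => -e) ⁻¹' E) := by
  refine ⟨H.finite.preimage neg_injective.injOn, fun e he e' he' => ?_, fun c d h => ?_,
    fun a ha => ?_, fun a ha => ?_, fun e he => ?_⟩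
  · have := H.same _ he _ he'
    simpa [and_comm] using this
  · rw [eval_derivative_comp_neg, eval_derivative_comp_neg]
    exact (H.sign_derivative _ _ h.of_neg).neg
  · rw [eval_derivative_comp_neg, neg_eq_zero] at ha
    obtain ⟨e, he, h⟩ := H.left _ ha
    exact ⟨-e, by simpa using he, by simp [h]⟩
  · rw [eval_derivative_comp_neg, neg_eq_zero] at ha
    obtain ⟨e, he, h⟩ := H.right _ ha
    exact ⟨-e, by simpa using he, by simp [h]⟩
  · simpa using H.sign _ he

theorem exists_root_of_derivative_pos (H : CriticalMatching f g E) (hR : PolynomialIVT R)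
    (hS : PolynomialIVT S) {c : R} {d : S} (hcd : SameCut E c d) (hc : 0 ≤ f.eval c)
    (hc' : 0 < f.derivative.eval c) (hd : g.eval d < 0) :
    ∃ b, g.eval b = 0 ∧ SameCut E c b := by
  have hne : ∀ e ∈ E, e.1 ≠ c := by
    intro e he hec
    have h2 := (hcd.eq_iff he).mp hec.symm
    have := H.sign e he
    rw [hec, ← h2] at this
    exact absurd (this.2.mpr hd) (not_lt.mpr hc)
  have hd' := (H.sign_derivative c d hcd).1.mp hc'
  by_cases hex : {e ∈ E | c < e.1}.Nonempty
  · obtain ⟨e, ⟨he, hce⟩, hmin⟩ := Set.exists_min_image _ Prod.fst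
      (H.finite.subset (Set.sep_subset _ _)) hex
    have hde := (hcd e he).2.mp hce
    have hfe : 0 < f.eval e.1 := by
      obtain ⟨x, hx1, hx2, hx⟩ := hR.exists_derivative_eq_slope f hce
      have hcut : SameCut E x d := by
        intro e' he'
        rcases lt_or_gt_of_ne (hne e' he') with h | h
        · have h3 := (hcd e' he').1.mp h
          have h4 := h.trans hx1
          simp [h3, h4, h3.not_gt, h4.not_gt]
        · have h3 := (hcd e' he').2.mp h
          have h4 := hx2.trans_le (hmin e' ⟨he', h⟩)
          simp [h3, h4, h3.not_gt, h4.not_gt]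
      have := mul_pos ((H.sign_derivative x d hcut).1.mpr hd') (sub_pos.mpr hce)
      linarith
    have hge := (H.sign e he).1.mp hfe
    obtain ⟨b, hb1, hb2, hb⟩ := hS g d e.2 hde (mul_neg_of_neg_of_pos hd hge)
    refine ⟨b, hb, fun e' he' => ?_⟩
    rcases lt_or_gt_of_ne (hne e' he') with h | h
    · have h3 := ((hcd e' he').1.mp h).trans hb1
      simp [h, h3, h.not_gt, h3.not_gt]
    · have h3 : b < e'.2 := by
        rcases (hmin e' ⟨he', h⟩).eq_or_lt with h4 | h4
        · rwa [((H.same e' he').eq_iff he).mp h4.symm]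
        · exact hb2.trans (((H.same e' he') e he).1.mp h4)
      simp [h, h3, h.not_gt, h3.not_gt]
  · have hlt : ∀ e ∈ E, e.1 < c := fun e he => by
      refine lt_of_le_of_ne (not_lt.mp fun h => hex ⟨e, he, h⟩) (hne e he)
    have hcut : ∀ b, d < b → SameCut E c b := fun b hb e he => by
      have h := hlt e he
      have h3 := ((hcd e he).1.mp h).trans hb
      simp [h, h3, h.not_gt, h3.not_gt]
    obtain ⟨m, hm, hgm⟩ := hS.exists_pos_of_derivative_pos (f := g) (c := d)
      (fun b hb => (H.sign_derivative c b (hcut b hb)).1.mp hc')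
    obtain ⟨b, hb1, hb2, hb⟩ := hS g d m hm (mul_neg_of_neg_of_pos hd hgm)
    exact ⟨b, hb, hcut b hb1⟩

theorem exists_root_of_neg (H : CriticalMatching f g E) (hR : PolynomialIVT R)
    (hS : PolynomialIVT S) {c : R} {d : S} (hcd : SameCut E c d) (hc : 0 ≤ f.eval c)
    (hd : g.eval d < 0) : ∃ b, g.eval b = 0 ∧ SameCut E c b := by
  rcases lt_trichotomy (f.derivative.eval c) 0 with h | h | h
  · obtain ⟨b, hb, hcb⟩ := H.reflect.exists_root_of_derivative_pos hR hS hcd.neg (by simpa)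
      (by simpa [eval_derivative_comp_neg] using h) (by simpa)
    exact ⟨-b, by simpa using hb, by simpa using hcb.of_neg⟩
  · obtain ⟨e, he, hec⟩ := H.left c h
    have h2 := (hcd.eq_iff he).mp hec.symm
    have := H.sign e he
    rw [hec, ← h2] at this
    exact absurd (this.2.mpr hd) (not_lt.mpr hc)
  · exact H.exists_root_of_derivative_pos hR hS hcd hc h hd

theorem exists_root (H : CriticalMatching f g E) (hR : PolynomialIVT R)
    (hS : PolynomialIVT S) {a : R} (ha : f.eval a = 0) : ∃ b, g.eval b = 0 ∧ SameCut E a b := by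
  obtain ⟨d, hd⟩ := exists_sameCut H.finite H.same a
  rcases lt_trichotomy (g.eval d) 0 with h | h | h
  · exact H.exists_root_of_neg hR hS hd ha.ge h
  · exact ⟨d, h, hd⟩
  · simpa using H.neg.exists_root_of_neg hR hS hd (by simp [ha]) (by simpa)

theorem addRoots_left (H : CriticalMatching f g E) (hR : PolynomialIVT R) (hS : PolynomialIVT S)
    {a : R} (ha : f.eval a = 0) : ∃ e ∈ addRoots f g E, e.1 = a := by
  obtain ⟨b, hb, hab⟩ := H.exists_root hR hS ha
  exact ⟨(a, b), .inr ⟨ha, hb, hab⟩, rfl⟩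

theorem addRoots_same (H : CriticalMatching f g E) (hR : PolynomialIVT R) (hS : PolynomialIVT S) :
    ∀ e ∈ addRoots f g E, SameCut (addRoots f g E) e.1 e.2 := by
  rintro e (he | ⟨h1, h2, h3⟩) e' (he' | ⟨h1', h2', h3'⟩)
  · exact H.same e he e' he'
  · exact ⟨(h3' e he).2, (h3' e he).1⟩
  · exact h3 e' he'
  · exact ⟨⟨H.lt_of_roots_lt hR h1' h1 h3' h3, H.swap.lt_of_roots_lt hS h2' h2 h3'.swap h3.swap⟩,
      ⟨H.lt_of_roots_lt hR h1 h1' h3 h3', H.swap.lt_of_roots_lt hS h2 h2' h3.swap h3'.swap⟩⟩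

theorem addRoots_pos (H : CriticalMatching f g E) (hR : PolynomialIVT R) (hS : PolynomialIVT S)
    {c : R} {d : S} (hcd : SameCut (addRoots f g E) c d) (hc : 0 < f.eval c) : 0 < g.eval d := by
  have hE : E ⊆ addRoots f g E := Set.subset_union_left
  have hcd' := hcd.mono hE
  rcases lt_trichotomy (g.eval d) 0 with h | h | h
  · exfalso
    obtain ⟨b, hb, hcb⟩ := H.exists_root_of_neg hR hS hcd' hc.le h
    obtain ⟨a, ha, hba⟩ := H.swap.exists_root hS hR hb
    have hab : SameCut E a b := hba.swap
    have hlt := hcd (a, b) (.inr ⟨ha, hb, hab⟩)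
    have hcut : ∀ x, (a < x ∧ x < c ∨ c < x ∧ x < a) → SameCut E x b := by
      intro x hx e he
      have := hab e he
      have := hcb e he
      grind
    have hcut' : ∀ y, (b < y ∧ y < d ∨ d < y ∧ y < b) → SameCut E a y := by
      intro y hy e he
      have := hab e he
      have := hcb e he
      have := hcd' e he
      grind
    have hne : a ≠ c := by rintro rfl; exact hc.ne' ha
    rcases lt_or_gt_of_ne hne with hac | hac
    · have hbd := hlt.1.mp hac
      obtain ⟨x, hx1, hx2, hx⟩ := hR.exists_derivative_eq_slope f hac
      obtain ⟨y, hy1, hy2, hy⟩ := hS.exists_derivative_eq_slope g hbd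
      have s1 := H.sign_derivative x b (hcut x (.inl ⟨hx1, hx2⟩))
      have s2 := H.sign_derivative a b hab
      have s3 := H.sign_derivative a y (hcut' y (.inl ⟨hy1, hy2⟩))
      rw [ha, sub_zero] at hx
      rw [hb, sub_zero] at hy
      simp only at hac hbd
      have p1 : 0 < f.derivative.eval x := by
        by_contra hcon
        nlinarith
      have p2 := s3.1.mp (s2.1.mpr (s1.1.mp p1))
      nlinarith
    · have hbd := hlt.2.mp hac
      obtain ⟨x, hx1, hx2, hx⟩ := hR.exists_derivative_eq_slope f hac
      obtain ⟨y, hy1, hy2, hy⟩ := hS.exists_derivative_eq_slope g hbd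
      have s1 := H.sign_derivative x b (hcut x (.inr ⟨hx1, hx2⟩))
      have s2 := H.sign_derivative a b hab
      have s3 := H.sign_derivative a y (hcut' y (.inr ⟨hy1, hy2⟩))
      rw [ha, zero_sub] at hx
      rw [hb, zero_sub] at hy
      simp only at hac hbd
      have p1 : f.derivative.eval x < 0 := by
        by_contra hcon
        nlinarith
      have p2 := s3.2.mp (s2.2.mpr (s1.2.mp p1))
      nlinarith
  · exfalso
    obtain ⟨a, ha, hda⟩ := H.swap.exists_root hS hR h
    have := (hcd.eq_iff (e := (a, d)) (.inr ⟨ha, h, hda.swap⟩)).mpr rfl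
    simp only at this
    exact hc.ne' (this ▸ ha)
  · exact h

theorem addRoots_sameSign (H : CriticalMatching f g E) (hR : PolynomialIVT R)
    (hS : PolynomialIVT S) {c : R} {d : S} (hcd : SameCut (addRoots f g E) c d) :
    SameSign (f.eval c) (g.eval d) := by
  have hneg : addRoots (-f) (-g) E = addRoots f g E := by simp [addRoots]
  have hdc : SameCut (addRoots g f (Prod.swap ⁻¹' E)) d c := by
    rw [addRoots_swap]
    exact hcd.swap
  have hdc' : SameCut (addRoots (-g) (-f) (Prod.swap ⁻¹' E)) d c := by
    rw [addRoots_swap, hneg]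
    exact hcd.swap
  refine ⟨⟨H.addRoots_pos hR hS hcd, H.swap.addRoots_pos hS hR hdc⟩, fun h => ?_, fun h => ?_⟩
  · have hcd' : SameCut (addRoots (-f) (-g) E) c d := by rwa [hneg]
    simpa using H.neg.addRoots_pos hR hS hcd' (by simpa)
  · simpa using H.neg.swap.addRoots_pos hS hR hdc' (by simpa)

end CriticalMatching
end SignMatching

section SignDiagram

theorem SameSign.of_mul {R S : Type*} [Field R] [LinearOrder R] [IsStrictOrderedRing R]
    [Field S] [LinearOrder S] [IsStrictOrderedRing S] {x a : R} {y b : S} (h : SameSign x y)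
    (hx : x ≠ 0) (hab : SameSign (x * a) (y * b)) : SameSign a b := by
  rcases lt_or_gt_of_ne hx with hx | hx
  · have hy := h.2.mp hx
    have := And.intro hab.2 hab.1
    simpa [SameSign, mul_pos_iff, mul_neg_iff, hx, hy, hx.not_gt, hy.not_gt, and_comm] using this
  · have hy := h.1.mp hx
    simpa [SameSign, mul_pos_iff, mul_neg_iff, hx, hy, hx.not_gt, hy.not_gt] using hab

theorem map_ne_zero_of_leadingCoeff {A K : Type*} [CommRing A] [Field K] {φ : A →+* K}
    {q : A[X]} (h : φ q.leadingCoeff ≠ 0) :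
    q.map φ ≠ 0 := by
  intro h0
  apply h
  rw [leadingCoeff, ← coeff_map, h0, coeff_zero]

theorem map_eraseLead_of_leadingCoeff_eq_zero {A K : Type*} [CommRing A] [Field K] {φ : A →+* K}
    {q : A[X]} (h : φ q.leadingCoeff = 0) :
    q.eraseLead.map φ = q.map φ := by
  conv_rhs => rw [← eraseLead_add_C_mul_X_pow q, Polynomial.map_add, Polynomial.map_mul, map_C, h]
  rw [C_0, zero_mul, add_zero]

theorem eval_map_cancelLeads {A K : Type*} [CommRing A] [Field K] {φ : A →+* K} {p q : A[X]} (hqp : q.natDegree ≤ p.natDegree) {a : K}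
    (ha : (q.map φ).eval a = 0) :
    ((q.cancelLeads p).map φ).eval a = φ q.leadingCoeff * (p.map φ).eval a := by
  simp [cancelLeads, Nat.sub_eq_zero_of_le hqp, ha]

variable {A R S : Type*} [CommRing A] [Field R] [LinearOrder R] [Field S] [LinearOrder S]

/-- `E` matches the roots of the specializations of the polynomials in `T` along `φ` with those
along `ψ`, compatibly with all signs. -/
structure SignDiagram (φ : A →+* R) (ψ : A →+* S) (T : Set A[X]) (E : Set (R × S)) : Prop where
  finite : E.Finite
  same : ∀ e ∈ E, SameCut E e.1 e.2
  sign : ∀ q ∈ T, ∀ c d, SameCut E c d → SameSign ((q.map φ).eval c) ((q.map ψ).eval d)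
  left : ∀ q ∈ T, q.map φ ≠ 0 → ∀ a, (q.map φ).eval a = 0 → ∃ e ∈ E, e.1 = a
  right : ∀ q ∈ T, q.map ψ ≠ 0 → ∀ b, (q.map ψ).eval b = 0 → ∃ e ∈ E, e.2 = b

namespace SignDiagram
variable {φ : A →+* R} {ψ : A →+* S} {T T₀ : Set A[X]} {E : Set (R × S)}

theorem mono (H : SignDiagram φ ψ T E) (hT : T₀ ⊆ T) : SignDiagram φ ψ T₀ E where
  finite := H.finite
  same := H.same
  sign q hq := H.sign q (hT hq)
  left q hq := H.left q (hT hq)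
  right q hq := H.right q (hT hq)

/-- Replacing polynomials by others with the same specializations. -/
theorem of_map_eq (H : SignDiagram φ ψ T E)
    (hT : ∀ q ∈ T₀, ∃ r ∈ T, r.map φ = q.map φ ∧ r.map ψ = q.map ψ) :
    SignDiagram φ ψ T₀ E := by
  refine ⟨H.finite, H.same, fun q hq => ?_, fun q hq => ?_, fun q hq => ?_⟩ <;>
    obtain ⟨r, hr, h1, h2⟩ := hT q hq
  · simpa only [h1, h2] using H.sign r hr
  · simpa only [h1] using H.left r hr
  · simpa only [h2] using H.right r hr

variable [IsStrictOrderedRing S]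

theorem restrict (H : SignDiagram φ ψ T E) (hS : PolynomialIVT S) (hT : T₀ ⊆ T)
    (h0 : ∀ q ∈ T₀, q.map φ = 0 ↔ q.map ψ = 0) :
    SignDiagram φ ψ T₀ {e ∈ E | ∃ q ∈ T₀, q.map φ ≠ 0 ∧ (q.map φ).eval e.1 = 0} := by
  have hsub : {e ∈ E | ∃ q ∈ T₀, q.map φ ≠ 0 ∧ (q.map φ).eval e.1 = 0} ⊆ E :=
    Set.sep_subset _ _
  have hroot : ∀ e ∈ E, ∀ q ∈ T₀, (q.map φ).eval e.1 = 0 ↔ (q.map ψ).eval e.2 = 0 :=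
    fun e he q hq => (H.sign q (hT hq) _ _ (H.same e he)).eq_zero_iff
  refine ⟨H.finite.subset hsub, fun e he => (H.same e (hsub he)).mono hsub,
    fun q hq c d hcd => ?_, fun q hq hq0 a ha => ?_, fun q hq hq0 a ha => ?_⟩
  · by_cases hq0 : q.map φ = 0
    · rw [hq0, (h0 q hq).mp hq0]
      simp [SameSign]
    obtain ⟨d', hd'⟩ := exists_sameCut H.finite H.same c
    have hs := H.sign q (hT hq) c d' hd'
    by_cases hdd : d' = d
    · rwa [← hdd]
    have hne : ∀ x, (d' ≤ x ∧ x ≤ d ∨ d ≤ x ∧ x ≤ d') → (q.map ψ).eval x ≠ 0 := by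
      intro x hx hx0
      obtain ⟨e, he, rfl⟩ := H.right q (hT hq) (fun h => hq0 ((h0 q hq).mpr h)) x hx0
      have h1 := hd' e he
      have h2 := hcd e ⟨he, q, hq, hq0, (hroot e he q hq).mpr hx0⟩
      grind
    have hpos : 0 < (q.map ψ).eval d' * (q.map ψ).eval d := by
      rcases le_total d' d with h | h
      · exact hS.mul_pos_of_forall_ne h fun x h1 h2 => hne x (.inl ⟨h1, h2⟩)
      · rw [mul_comm]
        exact hS.mul_pos_of_forall_ne h fun x h1 h2 => hne x (.inr ⟨h1, h2⟩)
    rcases mul_pos_iff.mp hpos with ⟨h1, h2⟩ | ⟨h1, h2⟩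
    · have h3 := hs.1.mpr h1
      simp [SameSign, h2, h3, h2.not_gt, h3.not_gt]
    · have h3 := hs.2.mpr h1
      simp [SameSign, h2, h3, h2.not_gt, h3.not_gt]
  · obtain ⟨e, he, rfl⟩ := H.left q (hT hq) hq0 a ha
    exact ⟨e, ⟨he, q, hq, hq0, ha⟩, rfl⟩
  · obtain ⟨e, he, rfl⟩ := H.right q (hT hq) hq0 a ha
    exact ⟨e, ⟨he, q, hq, fun h => hq0 ((h0 q hq).mp h), (hroot e he q hq).mpr ha⟩, rfl⟩

variable [IsStrictOrderedRing R]

theorem insert_addRoots (H : SignDiagram φ ψ T E) (hR : PolynomialIVT R) (hS : PolynomialIVT S)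
    {p : A[X]} (hp : derivative p ∈ T) (hφ : (derivative p).map φ ≠ 0)
    (hψ : (derivative p).map ψ ≠ 0)
    (hs : ∀ e ∈ E, SameSign ((p.map φ).eval e.1) ((p.map ψ).eval e.2)) :
    SignDiagram φ ψ (insert p T) (addRoots (p.map φ) (p.map ψ) E) := by
  have M : CriticalMatching (p.map φ) (p.map ψ) E := by
    refine ⟨H.finite, H.same, ?_, ?_, ?_, hs⟩
    · simpa only [derivative_map] using H.sign _ hp
    · simpa only [derivative_map] using H.left _ hp hφ
    · simpa only [derivative_map] using H.right _ hp hψ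
  have hE : E ⊆ addRoots (p.map φ) (p.map ψ) E := Set.subset_union_left
  refine ⟨M.finite_addRoots ?_ ?_, M.addRoots_same hR hS, ?_, ?_, ?_⟩
  · intro h
    rw [← derivative_map, h, derivative_zero] at hφ
    exact hφ rfl
  · intro h
    rw [← derivative_map, h, derivative_zero] at hψ
    exact hψ rfl
  · rintro q (rfl | hq) c d hcd
    · exact M.addRoots_sameSign hR hS hcd
    · exact H.sign q hq c d (hcd.mono hE)
  · rintro q (rfl | hq) hq0 a ha
    · exact M.addRoots_left hR hS ha
    · obtain ⟨e, he, h⟩ := H.left q hq hq0 a ha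
      exact ⟨e, hE he, h⟩
  · rintro q (rfl | hq) hq0 a ha
    · obtain ⟨e, he, h⟩ := M.swap.addRoots_left hS hR ha
      rw [addRoots_swap] at he
      exact ⟨e.swap, he, h⟩
    · obtain ⟨e, he, h⟩ := H.right q hq hq0 a ha
      exact ⟨e, hE he, h⟩

end SignDiagram

theorem isDershowitzMannaLT_map_degree [DecidableEq A[X]] {T Y : Multiset A[X]} {p : A[X]}
    (hp : p ∈ T) (hY : ∀ y ∈ Y, degree y < degree p) :
    Multiset.IsDershowitzMannaLT ((T.erase p + Y).map degree) (T.map degree) := by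
  refine ⟨(T.erase p).map degree, Y.map degree, {degree p}, by simp, by simp, ?_, by simpa using hY⟩
  conv_lhs => rw [← Multiset.cons_erase hp]
  simp [← Multiset.singleton_add, add_comm]

variable [IsStrictOrderedRing R] [IsStrictOrderedRing S] [IsAddTorsionFree A]

theorem exists_signDiagram (hR : PolynomialIVT R) (hS : PolynomialIVT S) (T : Multiset A[X]) :
    ∃ Q : Finset A, ∀ (φ : A →+* R) (ψ : A →+* S), (∀ x ∈ Q, SameSign (φ x) (ψ x)) →
      ∃ E, SignDiagram φ ψ {q | q ∈ T} E := by
  classical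
  induction T using (InvImage.wf (Multiset.map (degree (R := A)))
    Multiset.wellFounded_isDershowitzMannaLT).induction with
  | _ T ih =>
  by_cases hconst : ∀ q ∈ T, q.natDegree = 0
  · refine ⟨(T.map leadingCoeff).toFinset, fun φ ψ h => ⟨∅, by simp, by simp, ?_, ?_, ?_⟩⟩
    · intro q hq c d _
      have := h q.leadingCoeff (by
        rw [Multiset.mem_toFinset]
        exact Multiset.mem_map_of_mem _ hq)
      rw [leadingCoeff, hconst q hq] at this
      rw [eq_C_of_natDegree_eq_zero (hconst q hq)]
      simpa
    · intro q hq hq0 a ha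
      rw [eq_C_of_natDegree_eq_zero (hconst q hq)] at hq0 ha
      simp_all
    · intro q hq hq0 a ha
      rw [eq_C_of_natDegree_eq_zero (hconst q hq)] at hq0 ha
      simp_all
  push Not at hconst
  obtain ⟨q₀, hq₀, hq₀'⟩ := hconst
  obtain ⟨p, hp, hmax⟩ := Finset.exists_max_image T.toFinset natDegree ⟨q₀, by simpa⟩
  simp only [Multiset.mem_toFinset] at hp hmax
  have hp0 : 0 < p.natDegree := (Nat.pos_of_ne_zero hq₀').trans_le (hmax q₀ hq₀)
  have hpne : p ≠ 0 := by
    rintro rfl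
    simp at hp0
  let p' := derivative p
  have hp' : degree p' < degree p := degree_derivative_lt hpne
  let T₀ := p' ::ₘ T.erase p
  let Y := p' ::ₘ T₀.map (fun q => q.cancelLeads p)
  have hT₀le : ∀ q ∈ T₀, q.natDegree ≤ p.natDegree := by
    intro q hq
    rcases Multiset.mem_cons.mp hq with rfl | hq
    · exact natDegree_le_natDegree hp'.le
    · exact hmax q (Multiset.mem_of_mem_erase hq)
  obtain ⟨Q₂, hQ₂⟩ := ih (T.erase p + Y) (by
    refine isDershowitzMannaLT_map_degree hp fun y hy => ?_
    rcases Multiset.mem_cons.mp hy with rfl | hy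
    · exact hp'
    · obtain ⟨q, hq, rfl⟩ := Multiset.mem_map.mp hy
      exact degree_lt_degree
        (natDegree_cancelLeads_lt_of_natDegree_le_natDegree (hT₀le q hq) hp0))
  have herase : ∀ q, ∃ Q : Finset A, q ∈ T → q ≠ 0 → ∀ (φ : A →+* R) (ψ : A →+* S),
      (∀ x ∈ Q, SameSign (φ x) (ψ x)) →
      ∃ E, SignDiagram φ ψ {r | r ∈ T.erase q + {q.eraseLead}} E := by
    intro q
    by_cases hq : q ∈ T ∧ q ≠ 0
    · obtain ⟨Q, hQ⟩ := ih (T.erase q + {q.eraseLead})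
        (isDershowitzMannaLT_map_degree hq.1 (by simpa using degree_eraseLead_lt hq.2))
      exact ⟨Q, fun _ _ => hQ⟩
    · exact ⟨∅, fun h1 h2 => absurd ⟨h1, h2⟩ hq⟩
  choose Qe hQe using herase
  refine ⟨(T.map leadingCoeff).toFinset ∪ (T₀.map leadingCoeff).toFinset ∪ Q₂ ∪
    T.toFinset.biUnion Qe, fun φ ψ h => ?_⟩
  have hlc : ∀ q ∈ T, SameSign (φ q.leadingCoeff) (ψ q.leadingCoeff) := fun q hq => h _ (by
    simp only [Finset.mem_union, Multiset.mem_toFinset]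
    exact .inl (.inl (.inl (Multiset.mem_map_of_mem _ hq))))
  have hlc₀ : ∀ q ∈ T₀, SameSign (φ q.leadingCoeff) (ψ q.leadingCoeff) := fun q hq => h _ (by
    simp only [Finset.mem_union, Multiset.mem_toFinset]
    exact .inl (.inl (.inr (Multiset.mem_map_of_mem _ hq))))
  by_cases hz : ∃ q ∈ T, q ≠ 0 ∧ φ q.leadingCoeff = 0
  · obtain ⟨q, hq, hq0, hqφ⟩ := hz
    have hqψ := (hlc q hq).eq_zero_iff.mp hqφ
    obtain ⟨E, hE⟩ := hQe q hq hq0 φ ψ fun x hx => h x (by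
      simp only [Finset.mem_union, Finset.mem_biUnion, Multiset.mem_toFinset]
      exact .inr ⟨q, hq, hx⟩)
    refine ⟨E, hE.of_map_eq fun r hr => ?_⟩
    by_cases hrq : r = q
    · subst hrq
      exact ⟨r.eraseLead, by simp, map_eraseLead_of_leadingCoeff_eq_zero hqφ,
        map_eraseLead_of_leadingCoeff_eq_zero hqψ⟩
    · exact ⟨r, by simp [(Multiset.mem_erase_of_ne hrq).mpr hr], rfl, rfl⟩
  push Not at hz
  have hz₀ : ∀ q ∈ T₀, q ≠ 0 → φ q.leadingCoeff ≠ 0 := by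
    intro q hq hq0
    rcases Multiset.mem_cons.mp hq with rfl | hq
    · simpa [p', hp0.ne'] using hz p hp hpne
    · exact hz q (Multiset.mem_of_mem_erase hq) hq0
  have hz₀' : ∀ q ∈ T₀, q ≠ 0 → ψ q.leadingCoeff ≠ 0 := fun q hq hq0 h0 =>
    hz₀ q hq hq0 ((hlc₀ q hq).eq_zero_iff.mpr h0)
  have hp'T : p' ∈ T₀ := Multiset.mem_cons_self _ _
  have hpne' : p' ≠ 0 := derivative_ne_zero.mpr hp0.ne'
  obtain ⟨E₂, hE₂⟩ := hQ₂ φ ψ fun x hx => h x (by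
    simp only [Finset.mem_union]
    exact .inl (.inr hx))
  have hsub : {q | q ∈ T₀} ⊆ {q | q ∈ T.erase p + Y} := by
    intro q hq
    rcases Multiset.mem_cons.mp hq with rfl | hq
    · simp [Y]
    · simp [hq]
  have hE₀ := hE₂.restrict hS hsub (fun q hq => by
    by_cases hq0 : q = 0
    · simp [hq0]
    · simp [map_ne_zero_of_leadingCoeff (hz₀ q hq hq0),
        map_ne_zero_of_leadingCoeff (hz₀' q hq hq0)])
  refine ⟨_, (hE₀.insert_addRoots hR hS (p := p) hp'T
    (map_ne_zero_of_leadingCoeff (hz₀ _ hp'T hpne'))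
    (map_ne_zero_of_leadingCoeff (hz₀' _ hp'T hpne')) ?_).mono fun q hq => ?_⟩
  · rintro e ⟨he, q, hq, hqφ, hqe⟩
    have hq0 : q ≠ 0 := by
      rintro rfl
      simp at hqφ
    have hqe' := (hE₂.sign q (hsub hq) _ _ (hE₂.same e he)).eq_zero_iff.mp hqe
    have := hE₂.sign (q.cancelLeads p) (by
      simp only [Y, Set.mem_ofPred_eq, Multiset.mem_add, Multiset.mem_cons]
      exact .inr (.inr (Multiset.mem_map_of_mem (fun q => q.cancelLeads p) hq))) _ _
      (hE₂.same e he)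
    rw [eval_map_cancelLeads (hT₀le q hq) hqe, eval_map_cancelLeads (hT₀le q hq) hqe'] at this
    exact (hlc₀ q hq).of_mul (hz₀ q hq hq0) this
  · by_cases hqp : q = p
    · exact .inl hqp
    · exact .inr (Multiset.mem_cons_of_mem ((Multiset.mem_erase_of_ne hqp).mpr hq))

theorem exists_forall_sameSign_eval (hR : PolynomialIVT R) (hS : PolynomialIVT S)
    (T : Multiset A[X]) :
    ∃ Q : Finset A, ∀ (φ : A →+* R) (ψ : A →+* S), (∀ x ∈ Q, SameSign (φ x) (ψ x)) →
      ∀ c, ∃ d, ∀ q ∈ T, SameSign ((q.map φ).eval c) ((q.map ψ).eval d) := by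
  obtain ⟨Q, hQ⟩ := exists_signDiagram hR hS T
  refine ⟨Q, fun φ ψ h c => ?_⟩
  obtain ⟨E, hE⟩ := hQ φ ψ h
  obtain ⟨d, hd⟩ := exists_sameCut hE.finite hE.same c
  exact ⟨d, fun q hq => hE.sign q hq c d hd⟩

end SignDiagram

section Transfer

theorem eval_map_finSuccEquiv {k R : Type*} [CommRing k] [CommRing R] (φ : k →+* R) {n : ℕ}
    (c : R) (t : Fin n → R) (q : MvPolynomial (Fin (n + 1)) k) :
    ((MvPolynomial.finSuccEquiv k n q).map (MvPolynomial.eval₂Hom φ t)).eval c =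
      MvPolynomial.eval₂Hom φ (Fin.cons c t : Fin (n + 1) → R) q := by
  have : ((evalRingHom c).comp (mapRingHom (MvPolynomial.eval₂Hom φ t))).comp
      (MvPolynomial.finSuccEquiv k n : _ →+* _) =
        MvPolynomial.eval₂Hom φ (Fin.cons c t : Fin (n + 1) → R) := by
    apply MvPolynomial.ringHom_ext
    · intro r
      simp [MvPolynomial.finSuccEquiv_apply]
    · intro i
      refine Fin.cases ?_ (fun i => ?_) i <;> simp [MvPolynomial.finSuccEquiv_apply]
  exact RingHom.congr_fun this q

theorem exists_forall_sameSign_eval₂ {k R S : Type*} [CommRing k] [IsDomain k] [CharZero k]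
    [Field R] [LinearOrder R] [IsStrictOrderedRing R] [Field S] [LinearOrder S]
    [IsStrictOrderedRing S] (hR : PolynomialIVT R) (hS : PolynomialIVT S) (φ : k →+* R)
    (ψ : k →+* S) (h : ∀ x, SameSign (φ x) (ψ x)) {n : ℕ} (T : Multiset (MvPolynomial (Fin n) k))
    (a : Fin n → R) :
    ∃ b : Fin n → S, ∀ q ∈ T,
      SameSign (MvPolynomial.eval₂Hom φ a q) (MvPolynomial.eval₂Hom ψ b q) := by
  induction n with
  | zero =>
    refine ⟨Fin.elim0, fun q _ => ?_⟩
    obtain ⟨r, rfl⟩ := MvPolynomial.C_surjective (Fin 0) q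
    simpa using h r
  | succ n ih =>
    obtain ⟨Q, hQ⟩ := exists_forall_sameSign_eval hR hS (T.map (MvPolynomial.finSuccEquiv k n))
    obtain ⟨b, hb⟩ := ih Q.val (Fin.tail a)
    obtain ⟨d, hd⟩ := hQ (MvPolynomial.eval₂Hom φ (Fin.tail a)) (MvPolynomial.eval₂Hom ψ b) hb (a 0)
    refine ⟨Fin.cons d b, fun q hq => ?_⟩
    have := hd _ (Multiset.mem_map_of_mem _ hq)
    rwa [eval_map_finSuccEquiv, eval_map_finSuccEquiv, Fin.cons_self_tail] at this

theorem Real.polynomialIVT : PolynomialIVT ℝ := by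
  intro f a b hab h
  have hc : ContinuousOn (fun x => f.eval x) (Set.Icc a b) := f.continuous.continuousOn
  rcases mul_neg_iff.mp h with ⟨h1, h2⟩ | ⟨h1, h2⟩
  · obtain ⟨c, hc, hc0⟩ := intermediate_value_Ioo' hab.le hc ⟨h2, h1⟩
    exact ⟨c, hc.1, hc.2, hc0⟩
  · obtain ⟨c, hc, hc0⟩ := intermediate_value_Ioo hab.le hc ⟨h1, h2⟩
    exact ⟨c, hc.1, hc.2, hc0⟩

theorem Real.sameSign_ringHom {R : Type*} [Field R] [LinearOrder R] [IsStrictOrderedRing R]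
    (φ : ℝ →+* R) (x : ℝ) : SameSign (φ x) x := by
  have hpos : ∀ y, 0 < y → 0 < φ y := fun y hy => by
    have h0 : φ (√y) ≠ 0 := by simpa using (Real.sqrt_pos.mpr hy).ne'
    rw [← Real.mul_self_sqrt hy.le, map_mul]
    exact mul_self_pos.mpr h0
  rcases lt_trichotomy x 0 with h | rfl | h
  · have := hpos (-x) (by simpa)
    rw [map_neg, neg_pos] at this
    simp [SameSign, h, this, h.not_gt, this.not_gt]
  · simp [SameSign]
  · have := hpos x h
    simp [SameSign, h, this, h.not_gt, this.not_gt]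

end Transfer

section RealIdeal

theorem exists_mul_sq_eq_of_isSumSq_fractionRing {D K : Type*} [CommRing D] [IsDomain D] [Field K]
    [Algebra D K] [IsFractionRing D K] {s : K} (hs : IsSumSq s) :
    ∃ b t : D, b ≠ 0 ∧ IsSumSq t ∧ s * algebraMap D K b ^ 2 = algebraMap D K t := by
  induction hs with
  | zero => exact ⟨1, 0, one_ne_zero, .zero, by simp⟩
  | sq_add a _ ih =>
    obtain ⟨b, t, hb, ht, h⟩ := ih
    obtain ⟨u, v, hv, rfl⟩ := IsFractionRing.div_surjective (A := D) a
    have hv0 := nonZeroDivisors.ne_zero hv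
    have hv' : algebraMap D K v ≠ 0 := by simpa using hv0
    refine ⟨b * v, (u * b) * (u * b) + v * v * t, mul_ne_zero hb hv0,
      .sq_add _ ((IsSumSq.mul_self v).mul ht), ?_⟩
    simp only [map_mul, map_add, ← h]
    field_simp

theorem exists_isSumSq_of_surjective {A B : Type*} [Semiring A] [Semiring B] (f : A →+* B)
    (hf : Function.Surjective f) {t : B} (ht : IsSumSq t) : ∃ s, IsSumSq s ∧ f s = t := by
  induction ht with
  | zero => exact ⟨0, .zero, map_zero f⟩
  | sq_add a _ ih =>
    obtain ⟨s, hs, rfl⟩ := ih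
    obtain ⟨u, rfl⟩ := hf a
    exact ⟨_, .sq_add u hs, by simp⟩

theorem IsSumSq.exists_sum_eq {A : Type*} [CommSemiring A] {s : A} (hs : IsSumSq s) :
    ∃ (n : ℕ) (a : Fin n → A), s = ∑ j, a j ^ 2 := by
  induction hs with
  | zero => exact ⟨0, Fin.elim0, by simp⟩
  | sq_add a _ ih =>
    obtain ⟨n, b, rfl⟩ := ih
    exact ⟨n + 1, Fin.cons a b, by simp [Fin.sum_univ_succ, sq]⟩

theorem IsRealIdeal.not_isSumSq_neg_one {d : ℕ} {I : Ideal (MvPolynomial (Fin d) ℝ)} [I.IsPrime]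
    (hI : IsRealIdeal I) :
    ¬ IsSumSq (-1 : FractionRing (MvPolynomial (Fin d) ℝ ⧸ I)) := by
  intro h
  obtain ⟨b, t, hb, ht, h⟩ :=
    exists_mul_sq_eq_of_isSumSq_fractionRing (D := MvPolynomial (Fin d) ℝ ⧸ I) h
  obtain ⟨s, hs, rfl⟩ := exists_isSumSq_of_surjective _ Ideal.Quotient.mk_surjective ht
  obtain ⟨c, rfl⟩ := Ideal.Quotient.mk_surjective b
  obtain ⟨n, a, rfl⟩ := hs.exists_sum_eq
  rw [← map_pow, neg_one_mul, ← map_neg] at h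
  have h := IsFractionRing.injective _ _ h
  have hmem : ∑ j, (Fin.cons c a : Fin (n + 1) → _) j ^ 2 ∈ I := by
    rw [← Ideal.Quotient.eq_zero_iff_mem, Fin.sum_univ_succ]
    simp only [Fin.cons_zero, Fin.cons_succ, map_add, ← h, map_pow]
    ring
  exact hb (Ideal.Quotient.eq_zero_iff_mem.mpr (hI _ _ hmem 0))

/-- A ring homomorphism from real polynomials to an ordered field with the intermediate value
property can be replaced by a real point. -/
theorem exists_eval_of_ringHom {M : Type*} [Field M] [LinearOrder M] [IsStrictOrderedRing M]
    (hM : PolynomialIVT M) {n : ℕ} (θ : MvPolynomial (Fin n) ℝ →+* M)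
    (T : Multiset (MvPolynomial (Fin n) ℝ)) :
    ∃ b : Fin n → ℝ, ∀ q ∈ T, SameSign (θ q) (MvPolynomial.eval b q) := by
  have heval : MvPolynomial.eval₂Hom (θ.comp MvPolynomial.C) (fun i => θ (MvPolynomial.X i)) = θ :=
    MvPolynomial.ringHom_ext (by simp) (by simp)
  obtain ⟨b, hb⟩ := exists_forall_sameSign_eval₂ hM Real.polynomialIVT
    (θ.comp MvPolynomial.C) (RingHom.id ℝ) (Real.sameSign_ringHom _) T
    (fun i => θ (MvPolynomial.X i))
  rw [heval] at hb
  exact ⟨b, hb⟩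

theorem IsRealIdeal.mem_of_forall_eval_eq_zero {d : ℕ} {P f : MvPolynomial (Fin d) ℝ}
    [(Ideal.span {P}).IsPrime] (hI : IsRealIdeal (Ideal.span {P}))
    (hf : ∀ x, MvPolynomial.eval x P = 0 → MvPolynomial.eval x f = 0) : f ∈ Ideal.span {P} := by
  obtain ⟨M, hM⟩ := exists_isMaximalReal _ hI.not_isSumSq_neg_one
  obtain ⟨_, _, -⟩ := hM.exists_order
  let D := MvPolynomial (Fin d) ℝ ⧸ Ideal.span {P}
  let ι := (algebraMap (FractionRing D) M).comp (algebraMap D (FractionRing D))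
  have hι : Function.Injective ι :=
    (algebraMap (FractionRing D) M).injective.comp (IsFractionRing.injective D (FractionRing D))
  have hθ : ∀ q, ι.comp (Ideal.Quotient.mk (Ideal.span {P})) q = 0 ↔ q ∈ Ideal.span {P} :=
    fun q => (map_eq_zero_iff ι hι).trans Ideal.Quotient.eq_zero_iff_mem
  obtain ⟨b, hb⟩ := exists_eval_of_ringHom hM.polynomialIVT
    (ι.comp (Ideal.Quotient.mk (Ideal.span {P}))) {P, f}
  have hbP := (hb P (by simp)).eq_zero_iff.mp ((hθ P).mpr (Ideal.mem_span_singleton_self P))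
  exact (hθ f).mp ((hb f (by simp)).eq_zero_iff.mpr (hf b hbP))

end RealIdeal

end

/-- For an irreducible real polynomial `P` in `d` variables, the principal prime
ideal `(P)` is real if and only if `(P) = I(Z(P))`, the ideal of all polynomials
vanishing on the real zero set of `P`. -/
theorem stmt_9 (d : ℕ) (P : MvPolynomial (Fin d) ℝ) (hP : Irreducible P) :
    IsRealIdeal (Ideal.span {P}) ↔
      (Ideal.span {P} : Set (MvPolynomial (Fin d) ℝ)) =
        {f : MvPolynomial (Fin d) ℝ | ∀ x : Fin d → ℝ,
          MvPolynomial.eval x P = 0 → MvPolynomial.eval x f = 0} := by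
  constructor
  · intro hI
    have : (Ideal.span {P}).IsPrime := (Ideal.span_singleton_prime hP.ne_zero).mpr hP.prime
    ext f
    refine ⟨fun hf x hx => ?_, fun hf => hI.mem_of_forall_eval_eq_zero hf⟩
    obtain ⟨g, rfl⟩ := Ideal.mem_span_singleton.mp hf
    rw [map_mul, hx, zero_mul]
  · intro h n a ha j
    have hmem : ∀ f, f ∈ Ideal.span {P} ↔
        ∀ x, MvPolynomial.eval x P = 0 → MvPolynomial.eval x f = 0 := fun f => by
      rw [← SetLike.mem_coe, h, Set.mem_ofPred_eq]
    rw [hmem] at ha ⊢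
    intro x hx
    have := ha x hx
    simp only [map_sum, map_pow] at this
    rw [Finset.sum_eq_zero_iff_of_nonneg fun i _ => sq_nonneg _] at this
    simpa using this j (Finset.mem_univ j)
end

section
/- Let Z ⊆ ℝ² be a real algebraic plane curve of degree D. Then Z has O(D²) connected components. -/
namespace HarnackBound

open MvPolynomial

theorem two_mul_finrank_restrictTotalDegree (n : ℕ) :
    2 * Module.finrank ℝ (restrictTotalDegree (Fin 2) ℝ n) = (n + 1) * (n + 2) := by
  have hcard : Module.finrank ℝ (restrictTotalDegree (Fin 2) ℝ n) =
      Nat.card {m : Fin 2 →₀ ℕ | (m.sum fun _ e => e) ≤ n} :=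
    Module.finrank_eq_nat_card_basis (basisRestrictSupport ℝ _)
  let φ : {m : Fin 2 →₀ ℕ | (m.sum fun _ e => e) ≤ n} ≃
      ((Finset.range (n + 1)).sigma fun a => Finset.range (n + 1 - a)) :=
    { toFun := fun m => ⟨⟨m.1 0, m.1 1⟩, by
        have := m.2
        rw [Set.mem_ofPred_eq, Finsupp.sum_fintype _ _ (fun _ => rfl), Fin.sum_univ_two] at this
        simp only [Finset.mem_sigma, Finset.mem_range]; omega⟩
      invFun := fun p => ⟨Finsupp.equivFunOnFinite.symm ![p.1.1, p.1.2], by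
        have := p.2
        simp only [Finset.mem_sigma, Finset.mem_range] at this
        simp [Finsupp.sum_fintype]; omega⟩
      left_inv := fun m => by
        ext i; fin_cases i <;> simp
      right_inv := fun p => by
        simp }
  rw [hcard, Nat.card_congr φ, Nat.card_eq_fintype_card, Fintype.card_coe, Finset.card_sigma]
  simp only [Finset.card_range]
  clear hcard φ
  rw [← Finset.sum_range_reflect, mul_comm]
  have h : ∀ j ∈ Finset.range (n + 1), n + 1 - (n + 1 - 1 - j) = j + 1 := by
    intro j hj; simp at hj; omega
  rw [Finset.sum_congr rfl h]
  induction n with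
  | zero => simp
  | succ k ih =>
    rw [Finset.sum_range_succ, add_mul, ih]
    · ring
    · intro j hj; simp at hj; omega

theorem exists_eval_ne_zero_of_notMem {σ : Type*} (S : Finset (σ → ℝ)) (p : σ → ℝ) (hp : p ∉ S) :
    ∃ q : MvPolynomial σ ℝ, q.totalDegree ≤ S.card ∧ eval p q ≠ 0 ∧ ∀ x ∈ S, eval x q = 0 := by
  classical
  induction S using Finset.induction_on with
  | empty => exact ⟨1, by simp⟩
  | insert a S ha ih =>
    obtain ⟨q, hq, hqp, hqS⟩ := ih (fun h => hp (Finset.mem_insert_of_mem h))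
    obtain ⟨k, hk⟩ : ∃ k, p k ≠ a k := by
      by_contra! h
      exact hp (by simp [funext h])
    refine ⟨q * (X k - C (a k)), ?_, ?_, ?_⟩
    · rw [Finset.card_insert_of_notMem ha]
      refine (totalDegree_mul _ _).trans (add_le_add hq ?_)
      exact (totalDegree_sub_C_le _ _).trans (totalDegree_X _).le
    · simpa [hqp] using sub_ne_zero.2 hk
    · intro x hx
      rcases Finset.mem_insert.1 hx with rfl | hx
      · simp
      · simp [hqS x hx]

theorem finrank_map_mulLeft {q : MvPolynomial (Fin 2) ℝ} (hq : q ≠ 0)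
    (V : Submodule ℝ (MvPolynomial (Fin 2) ℝ)) :
    Module.finrank ℝ (V.map (LinearMap.mulLeft ℝ q)) = Module.finrank ℝ V :=
  (Submodule.equivMapOfInjective _ (fun _ _ h => mul_left_cancel₀ hq h) V).finrank_eq.symm

/-- Bézout's bound: a prime polynomial `f` and a polynomial not divisible by it have at most
`deg f * deg g` common zeros in the plane. -/
theorem card_common_zeros_le {f g : MvPolynomial (Fin 2) ℝ} (hf : Prime f) (hfg : ¬ f ∣ g)
    (S : Finset (Fin 2 → ℝ)) (hSf : ∀ x ∈ S, eval x f = 0) (hSg : ∀ x ∈ S, eval x g = 0) :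
    S.card ≤ f.totalDegree * g.totalDegree := by
  classical
  have hg : g ≠ 0 := by rintro rfl; exact hfg (dvd_zero _)
  have hf0 : f ≠ 0 := hf.ne_zero
  set d := f.totalDegree with hd
  set e := g.totalDegree with he
  set c := S.card with hc
  let V := restrictTotalDegree (Fin 2) ℝ
  let ev : MvPolynomial (Fin 2) ℝ →ₗ[ℝ] (S → ℝ) :=
    LinearMap.pi fun x => (aeval (R := ℝ) (x : Fin 2 → ℝ)).toLinearMap
  have hev : ∀ q (x : S), ev q x = eval (x : Fin 2 → ℝ) q := fun q x => by
    simp [ev, aeval_eq_eval]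
  let evV := ev.domRestrict (V (c + d + e))
  have hsurj : LinearMap.range evV = ⊤ := by
    rw [eq_top_iff, ← (Pi.basisFun ℝ S).span_eq, Submodule.span_le]
    rintro _ ⟨x, rfl⟩
    obtain ⟨q, hq, hqx, hqS⟩ := exists_eval_ne_zero_of_notMem (S.erase x) x (by simp)
    have hqV : C (eval x.1 q)⁻¹ * q ∈ V (c + d + e) := by
      rw [mem_restrictTotalDegree]
      refine (totalDegree_mul _ _).trans ?_
      have := hq.trans (Finset.card_erase_le)
      simp; omega
    refine ⟨⟨_, hqV⟩, ?_⟩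
    funext y
    simp only [evV, LinearMap.domRestrict_apply, hev, Pi.basisFun_apply]
    by_cases hyx : y = x
    · subst hyx; simp [hqx]
    · have := hqS y (Finset.mem_erase.2 ⟨fun h => hyx (Subtype.ext h), y.2⟩)
      simp [this, hyx]
  have hrn := LinearMap.finrank_range_add_finrank_ker evV
  rw [hsurj, finrank_top, Module.finrank_fintype_fun_eq_card, Fintype.card_coe] at hrn
  let A := (V (c + e)).map (LinearMap.mulLeft ℝ f)
  let B := (V (c + d)).map (LinearMap.mulLeft ℝ g)
  have hAB : A ⊔ B ≤ (LinearMap.ker evV).map (V (c + d + e)).subtype := by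
    refine sup_le ?_ ?_
    · rintro _ ⟨a, ha, rfl⟩
      have ha' := (mem_restrictTotalDegree _ _ _).1 ha
      refine ⟨⟨f * a, (mem_restrictTotalDegree _ _ _).2 ?_⟩, ?_, rfl⟩
      · exact (totalDegree_mul _ _).trans (by omega)
      · rw [SetLike.mem_coe, LinearMap.mem_ker]
        funext x
        simp [evV, hev, hSf x x.2]
    · rintro _ ⟨a, ha, rfl⟩
      have ha' := (mem_restrictTotalDegree _ _ _).1 ha
      refine ⟨⟨g * a, (mem_restrictTotalDegree _ _ _).2 ?_⟩, ?_, rfl⟩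
      · exact (totalDegree_mul _ _).trans (by omega)
      · rw [SetLike.mem_coe, LinearMap.mem_ker]
        funext x
        simp [evV, hev, hSg x x.2]
  have hABinf : A ⊓ B ≤ (V c).map (LinearMap.mulLeft ℝ (f * g)) := by
    rintro _ ⟨⟨a, ha, rfl⟩, ⟨b, hb, hab⟩⟩
    simp only [LinearMap.mulLeft_apply] at hab ⊢
    have hb' := (mem_restrictTotalDegree _ _ _).1 hb
    obtain ⟨t, rfl⟩ : f ∣ b := (hf.dvd_or_dvd (Dvd.intro a hab.symm)).resolve_left hfg
    refine ⟨t, (mem_restrictTotalDegree _ _ _).2 ?_, ?_⟩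
    · rcases eq_or_ne t 0 with rfl | ht
      · simp
      · rw [totalDegree_mul_of_isDomain hf0 ht] at hb'
        omega
    · rw [LinearMap.mulLeft_apply, ← hab]; ring
  have h1 := Submodule.finrank_mono hAB
  have h2 := Submodule.finrank_mono hABinf
  have h3 := Submodule.finrank_sup_add_finrank_inf_eq A B
  rw [Submodule.finrank_map_subtype_eq] at h1
  rw [finrank_map_mulLeft (mul_ne_zero hf0 hg)] at h2
  rw [finrank_map_mulLeft hf0, finrank_map_mulLeft hg] at h3
  have k0 := two_mul_finrank_restrictTotalDegree (c + d + e)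
  have k1 := two_mul_finrank_restrictTotalDegree (c + e)
  have k2 := two_mul_finrank_restrictTotalDegree (c + d)
  have k3 := two_mul_finrank_restrictTotalDegree c
  simp only [V] at *
  nlinarith

theorem exists_pderiv_ne_zero {σ : Type*} {f : MvPolynomial σ ℝ} (hf : f.totalDegree ≠ 0) :
    ∃ i, pderiv i f ≠ 0 := by
  classical
  rw [Ne, totalDegree_eq_zero_iff] at hf
  push Not at hf
  obtain ⟨m, hm, i, hi⟩ := hf
  refine ⟨i, fun h => ?_⟩
  have := congrArg (coeff (m - Finsupp.single i 1)) h
  rw [coeff_pderiv] at this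
  have hle : Finsupp.single i 1 ≤ m := by
    rw [Finsupp.single_le_iff]; omega
  rw [tsub_add_cancel_of_le hle] at this
  simp only [coeff_zero, mul_eq_zero] at this
  rcases this with h | h
  · exact (mem_support_iff.1 hm) h
  · exact absurd h (by positivity)

theorem totalDegree_pderiv_add_one_le {σ : Type*} {f : MvPolynomial σ ℝ} {i : σ}
    (hf : pderiv i f ≠ 0) : (pderiv i f).totalDegree + 1 ≤ f.totalDegree := by
  classical
  obtain ⟨m, hm, hmd⟩ := Finset.exists_mem_eq_sup _ (support_nonempty.2 hf)
    (fun s : σ →₀ ℕ => s.sum fun _ e => e)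
  have hmd' : (pderiv i f).totalDegree = m.sum fun _ e => e := hmd
  rw [mem_support_iff, coeff_pderiv] at hm
  have := le_totalDegree (mem_support_iff.2 (left_ne_zero_of_mul hm))
  rw [Finsupp.sum_add_index' (by simp) (by simp)] at this
  simpa [hmd'] using this

theorem not_dvd_pderiv {σ : Type*} {f : MvPolynomial σ ℝ} {i : σ}
    (hf : pderiv i f ≠ 0) : ¬ f ∣ pderiv i f := by
  rintro ⟨t, ht⟩
  have h1 := totalDegree_pderiv_add_one_le hf
  have hf0 : f ≠ 0 := by rintro rfl; simp at hf
  have ht0 : t ≠ 0 := by rintro rfl; simp [ht] at hf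
  rw [ht, totalDegree_mul_of_isDomain hf0 ht0] at h1
  omega

theorem hasStrictFDerivAt_eval {σ : Type*} [Fintype σ] (f : MvPolynomial σ ℝ) (p : σ → ℝ) :
    HasStrictFDerivAt (fun x => eval x f)
      (∑ i, eval p (pderiv i f) • ContinuousLinearMap.proj (R := ℝ) (φ := fun _ : σ => ℝ) i) p := by
  classical
  induction f using MvPolynomial.induction_on with
  | C a => simpa using hasStrictFDerivAt_const a p
  | add f g hf hg => 
    simp only [map_add, add_smul, Finset.sum_add_distrib]
    exact hf.add hg
  | mul_X f j hf =>
    have := hf.mul (ContinuousLinearMap.proj (R := ℝ) (φ := fun _ : σ => ℝ) j).hasStrictFDerivAt (x := p)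
    simp only [map_mul, eval_X]
    refine this.congr_fderiv ?_
    ext v
    simp [pderiv_X, add_mul, Finset.sum_add_distrib, Pi.single_apply, Finset.mul_sum,
      apply_ite (eval p), mul_assoc]

/-- At a zero of `f` where a partial derivative does not vanish, the component of the zero set
extends in the direction of the other coordinate. -/
theorem exists_lt_mem_connectedComponentIn {f : MvPolynomial (Fin 2) ℝ} {p : Fin 2 → ℝ}
    (hp : eval p f = 0) {i j : Fin 2} (hij : i ≠ j) (hi : eval p (pderiv i f) ≠ 0) :
    ∃ q ∈ connectedComponentIn {x | eval x f = 0} p, p j < q j := by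
  let pr (k : Fin 2) := ContinuousLinearMap.proj (R := ℝ) (φ := fun _ : Fin 2 => ℝ) k
  let L := ∑ k, eval p (pderiv k f) • pr k
  let F : (Fin 2 → ℝ) → ℝ × ℝ := fun x => (x j, eval x f)
  have hF : HasStrictFDerivAt F ((pr j).prod L) p :=
    (pr j).hasStrictFDerivAt.prodMk (hasStrictFDerivAt_eval f p)
  have hinj : Function.Injective ((pr j).prod L : (Fin 2 → ℝ) →ₗ[ℝ] ℝ × ℝ) := by
    rw [← LinearMap.ker_eq_bot, LinearMap.ker_eq_bot']
    intro v hv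
    have h1 : v j = 0 := congrArg Prod.fst hv
    have h2 : L v = 0 := congrArg Prod.snd hv
    have h3 : v i = 0 := by
      have : ∀ a : Fin 2, a = i ∨ a = j := by intro a; omega
      have h4 : L v = eval p (pderiv i f) * v i := by
        simp only [L, pr, sum_apply, smul_apply, ContinuousLinearMap.proj_apply,
          smul_eq_mul]
        refine Finset.sum_eq_single i (fun b _ hb => ?_) (by simp)
        rw [(this b).resolve_left hb, h1, mul_zero]
      rw [h4] at h2
      exact (mul_eq_zero.1 h2).resolve_left hi
    funext a
    rcases (by omega : a = i ∨ a = j) with rfl | rfl <;> simp [h1, h3]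
  let E := (LinearMap.linearEquivOfInjective _ hinj (by simp)).toContinuousLinearEquiv
  have hF' : HasStrictFDerivAt F (E : (Fin 2 → ℝ) →L[ℝ] ℝ × ℝ) p := by
    convert hF using 1
    ext v <;> rfl
  let e := hF'.toOpenPartialHomeomorph F
  have hpe : p ∈ e.source := hF'.mem_toOpenPartialHomeomorph_source
  have hFp : F p = (p j, 0) := by simp [F, hp]
  have htarget : e.target ∈ nhds (p j, (0 : ℝ)) := by
    rw [← hFp]; exact e.open_target.mem_nhds (e.map_source hpe)
  have hcont : ContinuousAt (fun t : ℝ => (t, (0 : ℝ))) (p j) := by fun_prop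
  obtain ⟨ε, hε, hball⟩ := Metric.mem_nhds_iff.1 (hcont htarget)
  let s := p j + ε / 2
  have hIcc : ∀ t ∈ Set.Icc (p j) s, (t, (0 : ℝ)) ∈ e.target := by
    intro t ht
    apply hball
    rw [Metric.mem_ball, Real.dist_eq, abs_of_nonneg (by linarith [ht.1])]
    have := ht.2
    simp only [s] at this
    linarith
  let γ : ℝ → Fin 2 → ℝ := fun t => e.symm (t, 0)
  have hFγ : ∀ t ∈ Set.Icc (p j) s, F (γ t) = (t, 0) := fun t ht => e.right_inv (hIcc t ht)
  have hγ : IsPreconnected (γ '' Set.Icc (p j) s) := by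
    refine isPreconnected_Icc.image _ ?_
    exact e.continuousOn_symm.comp (by fun_prop) hIcc
  have hps : p j ≤ s := by simp only [s]; linarith
  have hγp : γ (p j) = p := by
    simp only [γ]; rw [← hFp]; exact e.left_inv hpe
  have hsub := hγ.subset_connectedComponentIn (x := p) (F := {x | eval x f = 0})
    ⟨p j, ⟨le_rfl, hps⟩, hγp⟩ (by
      rintro _ ⟨t, ht, rfl⟩
      exact congrArg Prod.snd (hFγ t ht))
  refine ⟨γ s, hsub ⟨s, ⟨hps, le_rfl⟩, rfl⟩, ?_⟩
  have : γ s j = s := congrArg Prod.fst (hFγ s ⟨hps, le_rfl⟩)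
  rw [this]; simp only [s]; linarith

theorem isClosed_connectedComponentIn {X : Type*} [TopologicalSpace X] {Z : Set X}
    (hZ : IsClosed Z) (x : X) : IsClosed (connectedComponentIn Z x) := by
  by_cases hx : x ∈ Z
  · refine isClosed_of_closure_subset ?_
    exact isPreconnected_connectedComponentIn.closure.subset_connectedComponentIn
      (subset_closure (mem_connectedComponentIn hx))
      (closure_minimal (connectedComponentIn_subset _ _) hZ)
  · simp [connectedComponentIn_eq_empty hx]

/-- `Z` has at most `n` connected components. -/
def ComponentsLE {X : Type*} [TopologicalSpace X] (Z : Set X) (n : ℕ) : Prop :=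
  ∀ T : Finset X, (∀ x ∈ T, x ∈ Z) →
    (∀ x ∈ T, ∀ y ∈ T, y ∈ connectedComponentIn Z x → x = y) → T.card ≤ n

theorem ComponentsLE.union {X : Type*} [TopologicalSpace X] {Z W : Set X} {m n : ℕ}
    (hZ : ComponentsLE Z m) (hW : ComponentsLE W n) : ComponentsLE (Z ∪ W) (m + n) := by
  classical
  intro T hT hsep
  rw [← Finset.card_filter_add_card_filter_not (s := T) (· ∈ Z)]
  refine add_le_add (hZ _ (by simp) ?_) (hW _ ?_ ?_)
  · intro x hx y hy hxy
    exact hsep x (Finset.mem_filter.1 hx).1 y (Finset.mem_filter.1 hy).1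
      (connectedComponentIn_mono x Set.subset_union_left hxy)
  · intro x hx
    rw [Finset.mem_filter] at hx
    exact (hT x hx.1).resolve_left hx.2
  · intro x hx y hy hxy
    exact hsep x (Finset.mem_filter.1 hx).1 y (Finset.mem_filter.1 hy).1
      (connectedComponentIn_mono x Set.subset_union_right hxy)

theorem ComponentsLE.finite_and_card_le {X : Type*} [TopologicalSpace X] {Z : Set X} {n : ℕ}
    (hZ : ComponentsLE Z n) :
    Finite (ConnectedComponents Z) ∧ Nat.card (ConnectedComponents Z) ≤ n := by
  classical
  have hrep : ∀ c : ConnectedComponents Z, ∃ x : Z, (x : ConnectedComponents Z) = c :=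
    ConnectedComponents.surjective_coe
  choose r hr using hrep
  have hinj : Function.Injective fun c => (r c : X) := fun a b h => by
    rw [← hr a, ← hr b, Subtype.ext h]
  have key : ∀ s : Finset (ConnectedComponents Z), s.card ≤ n := by
    intro s
    rw [← Finset.card_image_of_injective s hinj]
    refine hZ _ ?_ ?_
    · simp only [Finset.mem_image]
      rintro _ ⟨c, -, rfl⟩
      exact (r c).2
    · simp only [Finset.mem_image]
      rintro _ ⟨a, -, rfl⟩ _ ⟨b, -, rfl⟩ hab
      rw [connectedComponentIn_eq_image (r a).2] at hab
      obtain ⟨z, hz, hzb⟩ := hab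
      obtain rfl : z = r b := Subtype.ext hzb
      have : a = b := by
        rw [← hr a, ← hr b]
        exact (ConnectedComponents.coe_eq_coe'.2 hz).symm
      rw [this]
  have hfin : Finite (ConnectedComponents Z) := by
    by_contra h
    rw [not_finite_iff_infinite] at h
    obtain ⟨s, hs⟩ := Infinite.exists_subset_card_eq (ConnectedComponents Z) (n + 1)
    have := key s
    omega
  refine ⟨hfin, ?_⟩
  have := Fintype.ofFinite (ConnectedComponents Z)
  rw [Nat.card_eq_fintype_card]
  exact key Finset.univ

theorem isClosed_zeros {σ : Type*} [Fintype σ] (f : MvPolynomial σ ℝ) :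
    IsClosed {x : σ → ℝ | eval x f = 0} :=
  isClosed_eq (MvPolynomial.continuous_eval f) continuous_const

theorem exists_finset_common_zeros {f g : MvPolynomial (Fin 2) ℝ} (hf : Prime f)
    (hfg : ¬ f ∣ g) : ∃ S : Finset (Fin 2 → ℝ), S.card ≤ f.totalDegree * g.totalDegree ∧
      ∀ x, eval x f = 0 → eval x g = 0 → x ∈ S := by
  have hfin : {x : Fin 2 → ℝ | eval x f = 0 ∧ eval x g = 0}.Finite := by
    by_contra h
    obtain ⟨t, ht, hcard⟩ := Set.Infinite.exists_subset_card_eq h (f.totalDegree * g.totalDegree + 1)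
    have := card_common_zeros_le hf hfg t (fun x hx => (ht hx).1) (fun x hx => (ht hx).2)
    omega
  refine ⟨hfin.toFinset, card_common_zeros_le hf hfg _ ?_ ?_, ?_⟩
  · intro x hx; exact (hfin.mem_toFinset.1 hx).1
  · intro x hx; exact (hfin.mem_toFinset.1 hx).2
  · intro x h1 h2; exact hfin.mem_toFinset.2 ⟨h1, h2⟩

/-- The equation of the circle around the origin with squared radius `r`. -/
noncomputable def circlePoly (r : ℝ) : MvPolynomial (Fin 2) ℝ := X 0 ^ 2 + X 1 ^ 2 - C r

theorem totalDegree_circlePoly_le (r : ℝ) : (circlePoly r).totalDegree ≤ 2 := by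
  refine (totalDegree_sub_C_le _ _).trans ((totalDegree_add _ _).trans (max_le ?_ ?_)) <;>
  exact (totalDegree_pow _ _).trans (by simp)

theorem exists_gt_not_dvd_circlePoly {f : MvPolynomial (Fin 2) ℝ} (hf : ¬ IsUnit f) (r : ℝ) :
    ∃ s > r, ¬ f ∣ circlePoly s := by
  by_contra! h
  have h1 := dvd_sub (h (r + 1) (by linarith)) (h (r + 2) (by linarith))
  have h2 : circlePoly (r + 1) - circlePoly (r + 2) = 1 := by
    simp only [circlePoly, sub_sub_sub_cancel_left, ← C_sub]
    norm_num
  rw [h2] at h1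
  exact hf (isUnit_of_dvd_one h1)

theorem componentsLE_zeros_of_irreducible {f : MvPolynomial (Fin 2) ℝ} (hf : Irreducible f) :
    ComponentsLE {x | eval x f = 0} (2 * f.totalDegree ^ 2) := by
  classical
  intro T hT hsep
  have hprime : Prime f := hf.prime
  have hdeg : f.totalDegree ≠ 0 := by
    intro h
    rw [totalDegree_eq_zero_iff_eq_C] at h
    apply hf.not_isUnit
    rw [h]
    refine (IsUnit.mk0 _ fun h0 => hf.ne_zero ?_).map C
    rw [h, h0, C_0]
  obtain ⟨i, hi⟩ := exists_pderiv_ne_zero hdeg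
  obtain ⟨j, hij⟩ : ∃ j, i ≠ j := (exists_ne i).imp fun _ h => h.symm
  let h : (Fin 2 → ℝ) → ℝ := fun x => x 0 ^ 2 + x 1 ^ 2
  have hcont : Continuous h := by fun_prop
  obtain ⟨r, hr⟩ : ∃ r, ∀ x ∈ T, h x ≤ r :=
    (T.finite_toSet.image h).bddAbove.imp fun r hr x hx => hr ⟨x, hx, rfl⟩
  obtain ⟨s, hs, hfs⟩ := exists_gt_not_dvd_circlePoly hf.not_isUnit r
  obtain ⟨A, hA, hAmem⟩ := exists_finset_common_zeros hprime hfs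
  obtain ⟨B, hB, hBmem⟩ := exists_finset_common_zeros hprime (not_dvd_pderiv hi)
  have key : ∀ x ∈ T, ∃ q ∈ connectedComponentIn {x | eval x f = 0} x, q ∈ A ∪ B := by
    intro x hx
    set K := connectedComponentIn {x | eval x f = 0} x with hK
    have hKZ : K ⊆ {x | eval x f = 0} := connectedComponentIn_subset _ _
    have hxK : x ∈ K := mem_connectedComponentIn (hT x hx)
    by_cases hex : ∃ y ∈ K, s ≤ h y
    · obtain ⟨y, hy, hys⟩ := hex
      obtain ⟨q, hq, hqs⟩ := isPreconnected_connectedComponentIn.intermediate_value hxK hy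
        hcont.continuousOn ⟨(hr x hx).trans hs.le, hys⟩
      refine ⟨q, hq, Finset.mem_union_left _ (hAmem q (hKZ hq) ?_)⟩
      simpa [circlePoly, sub_eq_zero] using hqs
    · push Not at hex
      have hcomp : IsCompact K := by
        refine Metric.isCompact_of_isClosed_isBounded
          (isClosed_connectedComponentIn (isClosed_zeros f) x)
          ((Metric.isBounded_closedBall (x := 0) (r := s + 1)).subset fun y hy => ?_)
        have hy' : y 0 ^ 2 + y 1 ^ 2 < s := hex y hy
        have hs0 : 0 < s := by nlinarith [sq_nonneg (y 0), sq_nonneg (y 1)]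
        rw [mem_closedBall_zero_iff, pi_norm_le_iff_of_nonneg (by linarith), Fin.forall_fin_two]
        constructor <;> rw [Real.norm_eq_abs] <;>
          refine abs_le_of_sq_le_sq ?_ (by linarith) <;>
          nlinarith [sq_nonneg (y 0), sq_nonneg (y 1)]
      obtain ⟨q, hq, hmax⟩ := hcomp.exists_isMaxOn ⟨x, hxK⟩ (continuous_apply j).continuousOn
      refine ⟨q, hq, Finset.mem_union_right _ (hBmem q (hKZ hq) ?_)⟩
      by_contra hne
      obtain ⟨z, hz, hlt⟩ := exists_lt_mem_connectedComponentIn (hKZ hq) hij hne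
      rw [← connectedComponentIn_eq hq] at hz
      exact absurd (hmax hz) (not_le.2 hlt)
  choose! q hqK hqAB using key
  have hcard : T.card ≤ (A ∪ B).card := by
    refine Finset.card_le_card_of_injOn q hqAB fun x hx y hy hxy => hsep x hx y hy ?_
    rw [connectedComponentIn_eq (hqK x hx), hxy, ← connectedComponentIn_eq (hqK y hy)]
    exact mem_connectedComponentIn (hT y hy)
  have h1 := hcard.trans (Finset.card_union_le _ _)
  have h2 := totalDegree_pderiv_add_one_le hi
  have h3 := totalDegree_circlePoly_le s
  have h4 : 1 ≤ f.totalDegree := Nat.one_le_iff_ne_zero.2 hdeg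
  have h5 := Nat.mul_le_mul_left f.totalDegree h2
  have h6 := Nat.mul_le_mul_left f.totalDegree h3
  have h7 := Nat.mul_le_mul_left f.totalDegree h4
  nlinarith

theorem componentsLE_zeros {f : MvPolynomial (Fin 2) ℝ} (hf : f ≠ 0) :
    ComponentsLE {x | eval x f = 0} (2 * f.totalDegree ^ 2) := by
  induction f using WfDvdMonoid.induction_on_irreducible with
  | zero => exact absurd rfl hf
  | unit u hu =>
    intro T hT _
    have : T = ∅ := Finset.eq_empty_of_forall_notMem fun x hx =>
      (hu.map (eval x)).ne_zero (hT x hx)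
    simp [this]
  | mul a i ha hi ih =>
    have hunion : {x | eval x (i * a) = 0} = {x | eval x i = 0} ∪ {x | eval x a = 0} := by
      ext x; simp
    intro T hT hsep
    rw [hunion] at hsep
    refine ((componentsLE_zeros_of_irreducible hi).union (ih ha) T (hunion ▸ hT) hsep).trans ?_
    rw [totalDegree_mul_of_isDomain hi.ne_zero ha]
    nlinarith [Nat.zero_le (i.totalDegree * a.totalDegree)]

end HarnackBound

/-- Harnack's theorem (up to constants): a real algebraic plane curve of degree
`D` has `O(D²)` connected components (in the Euclidean topology). -/
theorem stmt_11 :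
    ∃ C : ℝ, 0 < C ∧ ∀ f : MvPolynomial (Fin 2) ℝ, f ≠ 0 →
      Finite (ConnectedComponents {x : Fin 2 → ℝ // MvPolynomial.eval x f = 0}) ∧
      (Nat.card (ConnectedComponents {x : Fin 2 → ℝ // MvPolynomial.eval x f = 0}) : ℝ) ≤
        C * (f.totalDegree : ℝ) ^ 2 := by
  refine ⟨2, two_pos, fun f hf => ?_⟩
  obtain ⟨hfin, hcard⟩ := (HarnackBound.componentsLE_zeros hf).finite_and_card_le
  exact ⟨hfin, by exact_mod_cast hcard⟩
end

section
/- Let P be a finite collection of points in ℝ⁴ and let D > 0. Then there exists a nonzero polynomial P ∈ ℝ[x₁,x₂,x₃,x₄] of degree at most D such that each connected component of ℝ⁴ \ Z(P) contains at most O(|P|/D⁴) points of P. -/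
open Finset

section Balancing

/-- A nonzero subspace of `Fin N → ℝ` has a nonzero element whose support is contained in a
shortest possible initial segment. -/
lemma exists_mem_minimal_support {N : ℕ} (U : Submodule ℝ (Fin N → ℝ)) (hU : U ≠ ⊥) :
    ∃ v ∈ U, v ≠ 0 ∧ ∃ k : ℕ, (∀ j : Fin N, k < j → v j = 0) ∧
      ∀ w ∈ U, (∀ j : Fin N, k ≤ j → w j = 0) → w = 0 := by
  classical
  obtain ⟨u, huU, hu⟩ := U.exists_mem_ne_zero_of_ne_bot hU
  have hex : ∃ k : ℕ, ∃ v ∈ U, v ≠ 0 ∧ ∀ j : Fin N, k < j → v j = 0 :=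
    ⟨N, u, huU, hu, fun j hj => absurd j.isLt (by omega)⟩
  obtain ⟨v, hvU, hv, hvk⟩ := Nat.find_spec hex
  refine ⟨v, hvU, hv, Nat.find hex, hvk, fun w hwU hw => ?_⟩
  by_contra hne
  rcases Nat.eq_zero_or_pos (Nat.find hex) with h0 | hpos
  · exact hne (funext fun j => hw j (by omega))
  · exact Nat.find_min hex (m := Nat.find hex - 1) (by omega)
      ⟨w, hwU, hne, fun j hj => hw j (by omega)⟩

/-- Three vectors in the plane are linearly dependent. -/
lemma exists_plane_relation (a₁ a₂ b₁ b₂ c₁ c₂ : ℝ) :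
    ∃ α β γ : ℝ, (α ≠ 0 ∨ β ≠ 0 ∨ γ ≠ 0) ∧
      α * a₁ + β * b₁ + γ * c₁ = 0 ∧ α * a₂ + β * b₂ + γ * c₂ = 0 := by
  by_cases h : b₁ * c₂ - b₂ * c₁ = 0 ∧ c₁ * a₂ - c₂ * a₁ = 0 ∧ a₁ * b₂ - a₂ * b₁ = 0
  · obtain ⟨h1, h2, h3⟩ := h
    by_cases ha : a₁ = 0 ∧ a₂ = 0
    · exact ⟨1, 0, 0, by simp, by simp [ha.1], by simp [ha.2]⟩
    by_cases ha1 : a₁ = 0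
    · have ha2 : a₂ ≠ 0 := fun h => ha ⟨ha1, h⟩
      exact ⟨b₂, -a₂, 0, by simp [ha2], by linarith, by ring⟩
    · exact ⟨b₁, -a₁, 0, by simp [ha1], by ring, by linarith⟩
  · refine ⟨_, _, _, ?_, (by ring : (b₁ * c₂ - b₂ * c₁) * a₁ + (c₁ * a₂ - c₂ * a₁) * b₁ +
      (a₁ * b₂ - a₂ * b₁) * c₁ = 0), by ring⟩
    tauto

/-- If `va`, `vb`, `vc` span at most a plane and are killed by `la`, `lb`, `lc` respectively,
then one of them does not take values of the same strict sign at the other two functionals. -/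
lemma not_all_same_sign {V : Type*} [AddCommGroup V] [Module ℝ V] (la lb lc : V →ₗ[ℝ] ℝ)
    (va vb vc : V) (ha : la va = 0) (hb : lb vb = 0) (hc : lc vc = 0) {α β γ : ℝ}
    (hne : α ≠ 0 ∨ β ≠ 0 ∨ γ ≠ 0) (hrel : α • va + β • vb + γ • vc = 0) :
    ¬ (0 < lb va * lc va ∧ 0 < lc vb * la vb ∧ 0 < la vc * lb vc) := by
  rintro ⟨h1, h2, h3⟩
  have ea := congrArg la hrel
  have eb := congrArg lb hrel
  have ec := congrArg lc hrel
  simp only [map_add, map_smul, smul_eq_mul, map_zero, ha, hb, hc, mul_zero, zero_add,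
    add_zero] at ea eb ec
  have hα : α ≠ 0 := by
    rintro rfl
    have := right_ne_zero_of_mul h3.ne'
    have := left_ne_zero_of_mul h2.ne'
    simp_all
  have hβ : β ≠ 0 := by
    rintro rfl
    have := left_ne_zero_of_mul h3.ne'
    have := right_ne_zero_of_mul h1.ne'
    simp_all
  have hγ : γ ≠ 0 := by
    rintro rfl
    have := right_ne_zero_of_mul h2.ne'
    have := left_ne_zero_of_mul h1.ne'
    simp_all
  have hprod : 0 < (lb va * lc va) * (lc vb * la vb) * (la vc * lb vc) := by positivity
  have e1 : β * la vb = -(γ * la vc) := by linarith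
  have e2 : γ * lb vc = -(α * lb va) := by linarith
  have e3 : α * lc va = -(β * lc vb) := by linarith
  have key : (α * β * γ) ^ 2 * ((lb va * lc va) * (lc vb * la vb) * (la vc * lb vc)) =
      -((α * lb va) * (β * lc vb) * (γ * la vc)) ^ 2 := by
    calc _ = (α * β * γ) * ((α * lc va) * (β * la vb) * (γ * lb vc)) *
          (lb va * lc vb * la vc) := by ring
      _ = _ := by rw [e1, e2, e3]; ring
  have : 0 < (α * β * γ) ^ 2 * ((lb va * lc va) * (lc vb * la vb) * (la vc * lb vc)) := by
    positivity
  nlinarith [sq_nonneg ((α * lb va) * (β * lc vb) * (γ * la vc))]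

/-- The vectors of shortest support in the three hyperplane sections of a subspace are linearly
dependent. -/
lemma exists_relation_of_minimal_support {N : ℕ} (W : Submodule ℝ (Fin N → ℝ))
    (l : (Fin N → ℝ) →ₗ[ℝ] ℝ) (k : ℕ)
    (hmin : ∀ w ∈ W, l w = 0 → (∀ j : Fin N, k ≤ j → w j = 0) → w = 0)
    {va vb vc : Fin N → ℝ} (ha : va ∈ W) (hb : vb ∈ W) (hc : vc ∈ W)
    (hka : ∀ j : Fin N, k < j → va j = 0) (hkb : ∀ j : Fin N, k < j → vb j = 0)
    (hkc : ∀ j : Fin N, k < j → vc j = 0) :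
    ∃ α β γ : ℝ, (α ≠ 0 ∨ β ≠ 0 ∨ γ ≠ 0) ∧ α • va + β • vb + γ • vc = 0 := by
  let coord (v : Fin N → ℝ) : ℝ := if h : k < N then v ⟨k, h⟩ else 0
  obtain ⟨α, β, γ, hne, h1, h2⟩ :=
    exists_plane_relation (coord va) (l va) (coord vb) (l vb) (coord vc) (l vc)
  refine ⟨α, β, γ, hne, hmin _ ?_ ?_ fun j hj => ?_⟩
  · exact W.add_mem (W.add_mem (W.smul_mem _ ha) (W.smul_mem _ hb)) (W.smul_mem _ hc)
  · simpa using h2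
  · rcases hj.lt_or_eq with hlt | heq
    · simp [hka j hlt, hkb j hlt, hkc j hlt]
    · have hk : k < N := heq ▸ j.isLt
      have hj' : (⟨k, hk⟩ : Fin N) = j := Fin.ext heq
      simpa [coord, hk, hj'] using h1

/-- The number of ordered pairs in `T` at which `φ` takes values of the same strict sign. -/
noncomputable def sameSignPairs {X : Type*} (T : Finset X) (φ : X → ℝ) : ℕ :=
  ∑ a ∈ T, ∑ b ∈ T, if 0 < φ a * φ b then 1 else 0

lemma sum_triple_le {X : Type*} (T : Finset X) (h : X → X → X → ℕ)
    (H : ∀ a ∈ T, ∀ b ∈ T, ∀ c ∈ T, h a b c + h b c a + h c a b ≤ 2) :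
    3 * ∑ c ∈ T, ∑ a ∈ T, ∑ b ∈ T, h a b c ≤ 2 * #T ^ 3 := by
  have e1 : ∑ c ∈ T, ∑ a ∈ T, ∑ b ∈ T, h a b c = ∑ a ∈ T, ∑ b ∈ T, ∑ c ∈ T, h a b c := by
    rw [sum_comm]
    exact sum_congr rfl fun a _ => sum_comm
  have e2 : ∑ a ∈ T, ∑ b ∈ T, ∑ c ∈ T, h a b c = ∑ a ∈ T, ∑ b ∈ T, ∑ c ∈ T, h b c a := e1.symm
  have e3 : ∑ a ∈ T, ∑ b ∈ T, ∑ c ∈ T, h a b c = ∑ a ∈ T, ∑ b ∈ T, ∑ c ∈ T, h c a b := by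
    conv_rhs => rw [sum_comm]
    rw [← e1, sum_comm]
    rw [sum_comm]
    exact sum_congr rfl fun a _ => sum_comm
  calc 3 * ∑ c ∈ T, ∑ a ∈ T, ∑ b ∈ T, h a b c
      = ∑ a ∈ T, ∑ b ∈ T, ∑ c ∈ T, (h a b c + h b c a + h c a b) := by
        simp only [sum_add_distrib]
        rw [e1]; linarith
    _ ≤ ∑ a ∈ T, ∑ b ∈ T, ∑ c ∈ T, 2 :=
        sum_le_sum fun a ha => sum_le_sum fun b hb => sum_le_sum fun c hc => H a ha b hb c hc
    _ = 2 * #T ^ 3 := by simp; ring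

/-- A weak discrete ham sandwich theorem: in a space of functions whose dimension exceeds the
number of sets, some nonzero function has the same strict sign on at most two thirds of all
pairs of points lying in a common set. -/
theorem exists_balanced_functional {X ι : Type*} [Fintype ι] {N : ℕ} (hN : Fintype.card ι < N)
    (ev : X → (Fin N → ℝ) →ₗ[ℝ] ℝ) (S : ι → Finset X) (hS : ∀ i, (S i).Nonempty) :
    ∃ v : Fin N → ℝ, v ≠ 0 ∧
      3 * ∑ i, sameSignPairs (S i) (fun a => ev a v) ≤ 2 * ∑ i, #(S i) ^ 2 := by
  classical
  let U (q : ι → X) : Submodule ℝ (Fin N → ℝ) := LinearMap.ker (LinearMap.pi fun i => ev (q i))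
  have memU {q : ι → X} {v : Fin N → ℝ} : v ∈ U q ↔ ∀ i, ev (q i) v = 0 := by
    simp [U, funext_iff]
  have hU (q : ι → X) : U q ≠ ⊥ := LinearMap.ker_ne_bot_of_finrank_lt (by simpa using hN)
  choose v hvU hv k hk hmin using fun q => exists_mem_minimal_support (U q) (hU q)
  have triple (q : ι → X) (i : ι) (a b c : X) :
      ¬ (0 < ev b (v (Function.update q i a)) * ev c (v (Function.update q i a)) ∧
        0 < ev c (v (Function.update q i b)) * ev a (v (Function.update q i b)) ∧
        0 < ev a (v (Function.update q i c)) * ev b (v (Function.update q i c))) := by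
    let W : Submodule ℝ (Fin N → ℝ) := ⨅ j : {j // j ≠ i}, LinearMap.ker (ev (q j))
    have memW {w : Fin N → ℝ} : w ∈ W ↔ ∀ j, j ≠ i → ev (q j) w = 0 := by
      simp [W, Submodule.mem_iInf]
    have memUW (x : X) (w : Fin N → ℝ) : w ∈ U (Function.update q i x) ↔ w ∈ W ∧ ev x w = 0 := by
      rw [memU, memW]
      constructor
      · refine fun h => ⟨fun j hj => by simpa [hj] using h j, by simpa using h i⟩
      · rintro ⟨h1, h2⟩ j
        by_cases hj : j = i
        · subst hj; simpa using h2
        · simpa [hj] using h1 j hj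
    have hW (x : X) := (memUW x _).1 (hvU (Function.update q i x))
    have hm (x : X) (w : Fin N → ℝ) (hw : w ∈ W) (hx : ev x w = 0) :=
      hmin (Function.update q i x) w ((memUW x w).2 ⟨hw, hx⟩)
    obtain ⟨d, hd, hda, hdb, hdc⟩ : ∃ d : X, (d = a ∨ d = b ∨ d = c) ∧
        k (Function.update q i a) ≤ k (Function.update q i d) ∧
        k (Function.update q i b) ≤ k (Function.update q i d) ∧
        k (Function.update q i c) ≤ k (Function.update q i d) := by
      obtain ⟨d, hd, hdm⟩ := exists_max_image {a, b, c} (fun x => k (Function.update q i x))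
        ⟨a, by simp⟩
      exact ⟨d, by simpa using hd, hdm a (by simp), hdm b (by simp), hdm c (by simp)⟩
    obtain ⟨α, β, γ, hne, hrel⟩ := exists_relation_of_minimal_support W (ev d) _ (hm d)
      (hW a).1 (hW b).1 (hW c).1 (fun j hj => hk _ j (hda.trans_lt hj))
      (fun j hj => hk _ j (hdb.trans_lt hj)) (fun j hj => hk _ j (hdc.trans_lt hj))
    exact not_all_same_sign _ _ _ _ _ _ (hW a).2 (hW b).2 (hW c).2 hne hrel
  let Q := Fintype.piFinset S
  have hQ : Q.Nonempty := Fintype.piFinset_nonempty.2 hS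
  have average (i : ι) :
      3 * ∑ q ∈ Q, sameSignPairs (S i) (fun a => ev a (v q)) ≤ ∑ q ∈ Q, 2 * #(S i) ^ 2 := by
    have hpos : 0 < #(S i) := (hS i).card_pos
    have swap : #(S i) * ∑ q ∈ Q, sameSignPairs (S i) (fun a => ev a (v q)) =
        ∑ q ∈ Q, ∑ c ∈ S i, sameSignPairs (S i)
          (fun a => ev a (v (Function.update q i c))) := by
      have : #(S i) * ∑ q ∈ Q, sameSignPairs (S i) (fun a => ev a (v q)) =
          ∑ q ∈ Q, ∑ c ∈ S i, sameSignPairs (S i) (fun a => ev a (v q)) := by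
        simp [mul_sum]
      rw [this, ← sum_product', ← sum_product']
      have maps : ∀ x ∈ Q ×ˢ S i, (Function.update x.1 i x.2, x.1 i) ∈ Q ×ˢ S i := by
        rintro ⟨q, c⟩ hx
        simp only [mem_product, Q, Fintype.mem_piFinset] at hx ⊢
        refine ⟨fun j => ?_, hx.1 i⟩
        by_cases hj : j = i
        · subst hj; simpa using hx.2
        · simpa [hj] using hx.1 j
      refine sum_nbij' (fun x => (Function.update x.1 i x.2, x.1 i))
        (fun x => (Function.update x.1 i x.2, x.1 i)) maps maps ?_ ?_ ?_ <;>
      · rintro ⟨q, c⟩ -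
        simp
    have bound (q : ι → X) : 3 * ∑ c ∈ S i, sameSignPairs (S i)
          (fun a => ev a (v (Function.update q i c))) ≤ 2 * #(S i) ^ 3 := by
      refine sum_triple_le (S i) (fun a b c => if 0 < ev a (v (Function.update q i c)) *
        ev b (v (Function.update q i c)) then 1 else 0) fun a _ b _ c _ => ?_
      have := triple q i a b c
      split_ifs <;> first | omega | tauto
    refine Nat.le_of_mul_le_mul_left ?_ hpos
    calc #(S i) * (3 * ∑ q ∈ Q, sameSignPairs (S i) (fun a => ev a (v q)))
        = ∑ q ∈ Q, 3 * ∑ c ∈ S i, sameSignPairs (S i)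
          (fun a => ev a (v (Function.update q i c))) := by
          rw [mul_left_comm, swap, mul_sum]
      _ ≤ ∑ q ∈ Q, 2 * #(S i) ^ 3 := sum_le_sum fun q _ => bound q
      _ = #(S i) * ∑ q ∈ Q, 2 * #(S i) ^ 2 := by
          rw [mul_sum]; exact sum_congr rfl fun _ _ => by ring
  obtain ⟨q, -, hq⟩ := exists_le_of_sum_le
    (f := fun q => 3 * ∑ i, sameSignPairs (S i) (fun a => ev a (v q)))
    (g := fun _ => 2 * ∑ i, #(S i) ^ 2) hQ (by
      simp only [mul_sum]
      rw [sum_comm, sum_comm (s := Q)]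
      refine sum_le_sum fun i _ => ?_
      rw [← mul_sum]
      exact average i)
  exact ⟨v q, hv q, hq⟩

lemma card_sq_add_card_sq_le_sameSignPairs {X : Type*} (T : Finset X) (φ : X → ℝ) :
    #{a ∈ T | 0 < φ a} ^ 2 + #{a ∈ T | φ a < 0} ^ 2 ≤ sameSignPairs T φ := by
  have hsq (p : X → Prop) [DecidablePred p] :
      #{a ∈ T | p a} ^ 2 = ∑ a ∈ T, ∑ b ∈ T, if p a ∧ p b then 1 else 0 := by
    rw [sq, ← card_product, ← sum_product', ← card_filter, ← filter_product]
  rw [hsq, hsq, sameSignPairs, ← sum_add_distrib]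
  refine sum_le_sum fun a _ => ?_
  rw [← sum_add_distrib]
  refine sum_le_sum fun b _ => ?_
  by_cases h1 : 0 < φ a ∧ 0 < φ b
  · simp [h1, h1.1.not_gt, mul_pos h1.1 h1.2]
  · by_cases h2 : φ a < 0 ∧ φ b < 0
    · simp [h2, h2.1.not_gt, mul_pos_of_neg_of_neg h2.1 h2.2]
    · simp [h1, h2]

end Balancing

section Partitioning

open MvPolynomial

/-- A polynomial of degree at most `4 * t` that splits up to `t ^ 4` finite sets in a balanced
way on average. -/
theorem exists_balanced_polynomial {ι : Type*} [Fintype ι] (S : ι → Finset (Fin 4 → ℝ))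
    (hS : ∀ i, (S i).Nonempty) (t : ℝ) (ht : 0 ≤ t) (hcard : (Fintype.card ι : ℝ) ≤ t ^ 4) :
    ∃ f : MvPolynomial (Fin 4) ℝ, f ≠ 0 ∧ (f.totalDegree : ℝ) ≤ 4 * t ∧
      3 * ∑ i, (#{a ∈ S i | 0 < eval a f} ^ 2 + #{a ∈ S i | eval a f < 0} ^ 2) ≤
        2 * ∑ i, #(S i) ^ 2 := by
  set k := ⌊t⌋₊ with hk
  let e := (Fintype.equivFin (Fin 4 → Fin (k + 1))).symm
  let expo (j : Fin (Fintype.card (Fin 4 → Fin (k + 1)))) : Fin 4 →₀ ℕ :=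
    Finsupp.equivFunOnFinite.symm fun i => (e j i : ℕ)
  have hinj : Function.Injective expo := fun j j' h => e.injective <| funext fun i =>
    Fin.ext (by simpa [expo] using DFunLike.congr_fun h i)
  have hN : Fintype.card ι < Fintype.card (Fin 4 → Fin (k + 1)) := by
    have h1 : t < k + 1 := Nat.lt_floor_add_one t
    have h2 : t ^ 4 < ((k : ℝ) + 1) ^ 4 := by gcongr
    simp only [Fintype.card_pi, Fintype.card_fin, prod_const, card_univ]
    exact_mod_cast hcard.trans_lt h2
  let poly : (Fin (Fintype.card (Fin 4 → Fin (k + 1))) → ℝ) →ₗ[ℝ] MvPolynomial (Fin 4) ℝ :=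
    Fintype.linearCombination ℝ fun j => monomial (expo j) (1 : ℝ)
  have hindep : LinearIndependent ℝ fun j => monomial (expo j) (1 : ℝ) := by
    simpa [Function.comp_def] using (basisMonomials (Fin 4) ℝ).linearIndependent.comp expo hinj
  obtain ⟨v, hv, hbal⟩ := exists_balanced_functional hN
    (fun x => (aeval x).toLinearMap ∘ₗ poly) S hS
  refine ⟨poly v, ?_, ?_, ?_⟩
  · intro h
    refine hv (funext fun j => ?_)
    exact Fintype.linearIndependent_iff.1 hindep v
      (by simpa [poly, Fintype.linearCombination_apply] using h) j
  · have hdeg : (poly v).totalDegree ≤ 4 * k := by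
      simp only [poly, Fintype.linearCombination_apply]
      refine totalDegree_finsetSum_le fun j _ => (totalDegree_smul_le _ _).trans ?_
      refine (totalDegree_monomial_le _ _).trans ?_
      rw [Finsupp.sum_fintype _ _ (fun _ => rfl)]
      calc ∑ i, expo j i ≤ ∑ _i : Fin 4, k := sum_le_sum fun i _ => by
            simpa [expo] using Nat.lt_succ_iff.1 (e j i).isLt
        _ = 4 * k := by simp
    calc ((poly v).totalDegree : ℝ) ≤ ((4 * k : ℕ) : ℝ) := by exact_mod_cast hdeg
      _ = 4 * k := by push_cast; ring
      _ ≤ 4 * t := by gcongr; exact Nat.floor_le ht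
  · refine le_trans ?_ hbal
    gcongr with i
    simpa [aeval_def, eval₂_eq_eval_map] using
      card_sq_add_card_sq_le_sameSignPairs (S i) (fun a => eval a (poly v))

/-- The connected component of `x` in the complement of the zero set of `f`. -/
abbrev zeroSetCell (f : MvPolynomial (Fin 4) ℝ) (x : Fin 4 → ℝ) : Set (Fin 4 → ℝ) :=
  connectedComponentIn {y | eval y f ≠ 0} x

lemma zeroSetCell_mul_subset_left (f g : MvPolynomial (Fin 4) ℝ) (x : Fin 4 → ℝ) :
    zeroSetCell (f * g) x ⊆ zeroSetCell f x :=
  connectedComponentIn_mono x fun y hy => by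
    simp only [Set.mem_ofPred_eq, map_mul] at hy ⊢
    exact left_ne_zero_of_mul hy

lemma zeroSetCell_mul_subset_right (f g : MvPolynomial (Fin 4) ℝ) (x : Fin 4 → ℝ) :
    zeroSetCell (f * g) x ⊆ zeroSetCell g x := by
  rw [mul_comm]
  exact zeroSetCell_mul_subset_left g f x

/-- A polynomial has constant sign on each cell of the complement of its zero set. -/
lemma eval_mul_eval_pos_of_mem_zeroSetCell {f : MvPolynomial (Fin 4) ℝ} {x y z : Fin 4 → ℝ}
    (hy : y ∈ zeroSetCell f x) (hz : z ∈ zeroSetCell f x) : 0 < eval y f * eval z f := by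
  have hne (w) (hw : w ∈ zeroSetCell f x) : eval w f ≠ 0 :=
    connectedComponentIn_subset {y | eval y f ≠ 0} x hw
  have hconn : ((fun w => eval w f) '' zeroSetCell f x).OrdConnected :=
    (isPreconnected_connectedComponentIn.image _ f.continuous_eval.continuousOn).ordConnected
  have hzero : (0 : ℝ) ∉ (fun w => eval w f) '' zeroSetCell f x := by
    rintro ⟨w, hw, h0⟩
    exact hne w hw h0
  have hy' := Set.mem_image_of_mem (fun w => eval w f) hy
  have hz' := Set.mem_image_of_mem (fun w => eval w f) hz
  by_contra hle
  rcases mul_nonpos_iff.1 (not_lt.1 hle) with h | h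
  · exact hzero (hconn.out hz' hy' ⟨h.2, h.1⟩)
  · exact hzero (hconn.out hy' hz' ⟨h.1, h.2⟩)

open Classical in
/-- Cut every set of a finite family down to size at most `s`, by a polynomial whose degree is
controlled by the sum of the squares of the cardinalities. -/
theorem exists_cutting_polynomial (s : ℝ) (hs : 0 < s) (n : ℕ) :
    ∀ (ι : Type) [Fintype ι] (S : ι → Finset (Fin 4 → ℝ)) (t : ℝ), 0 ≤ t →
      ∑ i, #(S i) ^ 2 ≤ n → (∑ i, #(S i) ^ 2 : ℕ) ≤ s ^ 2 * t ^ 4 →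
      ∃ g : MvPolynomial (Fin 4) ℝ, g ≠ 0 ∧ (g.totalDegree : ℝ) ≤ 45 * t ∧
        ∀ x, eval x g ≠ 0 → ∀ i, (#{p ∈ S i | p ∈ zeroSetCell g x} : ℝ) ≤ s := by
  induction n using Nat.strong_induction_on with
  | _ n ih =>
  intro ι _ S t ht hn hsum
  let heavy := {i : ι // s < #(S i)}
  have light (g : MvPolynomial (Fin 4) ℝ) (x : Fin 4 → ℝ) (i : ι) (hi : ¬ s < #(S i)) :
      (#{p ∈ S i | p ∈ zeroSetCell g x} : ℝ) ≤ s :=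
    le_trans (by exact_mod_cast card_filter_le _ _) (not_lt.1 hi)
  rcases isEmpty_or_nonempty heavy with hempty | hnonempty
  · exact ⟨1, one_ne_zero, by simpa using ht, fun x _ i => light 1 x i fun hi =>
      hempty.false ⟨i, hi⟩⟩
  have hpos (i : heavy) : 0 < #(S i) := by exact_mod_cast hs.trans i.2
  have hle : ∑ i : heavy, #(S i) ^ 2 ≤ ∑ i, #(S i) ^ 2 :=
    (sum_map univ (Function.Embedding.subtype _) (fun i => #(S i) ^ 2)).symm.trans_le
      (sum_le_sum_of_subset (subset_univ _))
  have hcard : (Fintype.card heavy : ℝ) ≤ t ^ 4 := by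
    have h1 : (Fintype.card heavy : ℝ) * s ^ 2 ≤ (∑ i : heavy, #(S i) ^ 2 : ℕ) := by
      push_cast
      rw [← nsmul_eq_mul, ← card_univ]
      refine card_nsmul_le_sum _ _ _ fun i _ => ?_
      have := i.2.le
      gcongr
    have h2 : ((∑ i : heavy, #(S i) ^ 2 : ℕ) : ℝ) ≤ (∑ i, #(S i) ^ 2 : ℕ) := by
      exact_mod_cast hle
    have h3 : (Fintype.card heavy : ℝ) * s ^ 2 ≤ t ^ 4 * s ^ 2 := by linarith
    exact le_of_mul_le_mul_right h3 (by positivity)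
  obtain ⟨f, hf, hfdeg, hfbal⟩ := exists_balanced_polynomial (fun i : heavy => S i)
    (fun i => card_pos.1 (hpos i)) t ht hcard
  let S' (j : heavy × Bool) : Finset (Fin 4 → ℝ) :=
    if j.2 then {a ∈ S j.1 | 0 < eval a f} else {a ∈ S j.1 | eval a f < 0}
  have hsum' : 3 * ∑ j, #(S' j) ^ 2 ≤ 2 * ∑ i : heavy, #(S i) ^ 2 := by
    simpa [S', Fintype.sum_prod_type] using hfbal
  have hΨ : 0 < ∑ i : heavy, #(S i) ^ 2 :=
    sum_pos (fun i _ => pow_pos (hpos i) 2) univ_nonempty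
  obtain ⟨g, hg, hgdeg, hgcut⟩ := ih (∑ j, #(S' j) ^ 2) (by omega) (heavy × Bool) S' (0.91 * t)
    (by positivity) le_rfl (by
      have h1 : 3 * ((∑ j, #(S' j) ^ 2 : ℕ) : ℝ) ≤ 2 * (∑ i, #(S i) ^ 2 : ℕ) := by
        exact_mod_cast hsum'.trans (by omega)
      have h2 : 0 ≤ s ^ 2 * t ^ 4 := by positivity
      rw [mul_pow]
      nlinarith)
  refine ⟨f * g, mul_ne_zero hf hg, ?_, fun x hx i => ?_⟩
  · have : ((f * g).totalDegree : ℝ) ≤ f.totalDegree + g.totalDegree := by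
      exact_mod_cast totalDegree_mul f g
    linarith
  · by_cases hi : s < #(S i)
    · have hxf : eval x f ≠ 0 := by
        rw [map_mul] at hx; exact left_ne_zero_of_mul hx
      have hxg : eval x g ≠ 0 := by
        rw [map_mul] at hx; exact right_ne_zero_of_mul hx
      refine le_trans ?_ (hgcut x hxg (⟨i, hi⟩, decide (0 < eval x f)))
      refine Nat.cast_le.2 (card_le_card fun p hp => ?_)
      simp only [mem_filter] at hp ⊢
      refine ⟨?_, zeroSetCell_mul_subset_right f g x hp.2⟩
      have hsign : 0 < eval p f * eval x f := eval_mul_eval_pos_of_mem_zeroSetCell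
        (zeroSetCell_mul_subset_left f g x hp.2) (mem_connectedComponentIn hxf)
      by_cases hx0 : 0 < eval x f
      · simpa [S', hx0, hp.1] using pos_of_mul_pos_left hsign hx0.le
      · have : eval x f < 0 := lt_of_le_of_ne (not_lt.1 hx0) hxf
        simpa [S', hx0, hp.1] using neg_of_mul_pos_left hsign this.le
    · exact light _ x i hi

open Classical in
/-- Polynomial partitioning at the dyadic scale `16 ^ j`. -/
theorem exists_partitioning_polynomial_dyadic (P : Finset (Fin 4 → ℝ)) (j : ℕ) :
    ∃ f : MvPolynomial (Fin 4) ℝ, f ≠ 0 ∧ (f.totalDegree : ℝ) ≤ 180 * (2 ^ j - 1) ∧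
      ∀ x, eval x f ≠ 0 → (#{p ∈ P | p ∈ zeroSetCell f x} : ℝ) ≤ #P / 16 ^ j := by
  induction j with
  | zero =>
    refine ⟨1, one_ne_zero, by simp, fun x _ => ?_⟩
    simpa using card_filter_le P _
  | succ j ih =>
    obtain ⟨f, hf, hfdeg, hfcut⟩ := ih
    rcases P.eq_empty_or_nonempty with rfl | hP
    · refine ⟨1, one_ne_zero, ?_, fun x _ => by simp⟩
      have : (1 : ℝ) ≤ 2 ^ (j + 1) := one_le_pow₀ (by norm_num)
      simpa using this
    set s : ℝ := #P / 16 ^ (j + 1) with hs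
    have hPpos : (0 : ℝ) < #P := by exact_mod_cast hP.card_pos
    have hspos : 0 < s := by positivity
    have hPs : (#P : ℝ) = s * 16 ^ (j + 1) := by rw [hs]; field_simp
    let cells : Finset (Finset (Fin 4 → ℝ)) :=
      image (fun p => {q ∈ P | q ∈ zeroSetCell f p}) {p ∈ P | eval p f ≠ 0}
    have hcell (c) (hc : c ∈ cells) : (#c : ℝ) ≤ 16 * s := by
      obtain ⟨p, hp, rfl⟩ := mem_image.1 hc
      refine (hfcut p (mem_filter.1 hp).2).trans_eq ?_
      rw [hPs]; field_simp; ring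
    have hdisj : (cells : Set (Finset (Fin 4 → ℝ))).PairwiseDisjoint id := by
      intro c hc c' hc' hne
      obtain ⟨p, hp, rfl⟩ := mem_image.1 hc
      obtain ⟨p', hp', rfl⟩ := mem_image.1 hc'
      refine disjoint_left.2 fun q hq hq' => hne ?_
      have h1 := connectedComponentIn_eq (mem_filter.1 hq).2
      have h2 := connectedComponentIn_eq (mem_filter.1 hq').2
      simp only [zeroSetCell, h1, h2]
    have hcard : ∑ c ∈ cells, #c ≤ #P := by
      refine (card_biUnion (t := id) hdisj).symm.trans_le ?_
      refine card_le_card fun q hq => ?_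
      obtain ⟨c, hc, hqc⟩ := mem_biUnion.1 hq
      obtain ⟨p, hp, rfl⟩ := mem_image.1 hc
      exact (mem_filter.1 hqc).1
    obtain ⟨g, hg, hgdeg, hgcut⟩ := exists_cutting_polynomial s hspos _ cells
      (fun c => c.1) (2 ^ (j + 2)) (by positivity) le_rfl (by
        rw [sum_coe_sort cells (fun c => #c ^ 2)]
        push_cast
        calc ∑ c ∈ cells, (#c : ℝ) ^ 2 ≤ ∑ c ∈ cells, 16 * s * (#c : ℝ) :=
              sum_le_sum fun c hc => by
                rw [sq]; exact mul_le_mul_of_nonneg_right (hcell c hc) (Nat.cast_nonneg _)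
          _ = 16 * s * ((∑ c ∈ cells, #c : ℕ) : ℝ) := by rw [← mul_sum, Nat.cast_sum]
          _ ≤ 16 * s * #P :=
              mul_le_mul_of_nonneg_left (Nat.cast_le.2 hcard) (by linarith)
          _ = s ^ 2 * (2 ^ (j + 2)) ^ 4 := by
              rw [hPs, ← pow_mul, mul_comm (j + 2) 4, pow_mul]; norm_num; ring)
    refine ⟨f * g, mul_ne_zero hf hg, ?_, fun x hx => ?_⟩
    · have : ((f * g).totalDegree : ℝ) ≤ f.totalDegree + g.totalDegree := by
        exact_mod_cast totalDegree_mul f g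
      rw [pow_add] at hgdeg ⊢
      linarith
    · have hxg : eval x g ≠ 0 := by
        rw [map_mul] at hx; exact right_ne_zero_of_mul hx
      rcases Finset.eq_empty_or_nonempty {p ∈ P | p ∈ zeroSetCell (f * g) x} with he | ⟨p, hp⟩
      · rw [he]; simpa using hspos.le
      have hpP := (mem_filter.1 hp).1
      have hpf := zeroSetCell_mul_subset_left f g x (mem_filter.1 hp).2
      have hp0 : eval p f ≠ 0 := connectedComponentIn_subset {y | eval y f ≠ 0} x hpf
      refine le_trans ?_ (hgcut x hxg ⟨_, mem_image_of_mem _ (mem_filter.2 ⟨hpP, hp0⟩)⟩)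
      refine Nat.cast_le.2 (card_le_card fun q hq => ?_)
      simp only [mem_filter] at hq ⊢
      refine ⟨⟨hq.1, ?_⟩, zeroSetCell_mul_subset_right f g x hq.2⟩
      rw [zeroSetCell, ← connectedComponentIn_eq hpf]
      exact zeroSetCell_mul_subset_left f g x hq.2

end Partitioning


/-- Polynomial ham sandwich cell decomposition (Guth–Katz polynomial
partitioning) in `ℝ⁴`: for any finite point set `P` in `ℝ⁴` and any `D > 0`,
there is a nonzero polynomial of degree at most `D` such that each connected
component of the complement of its zero set contains at most `O(|P|/D⁴)`
points of `P`. -/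
theorem stmt_12 :
    ∃ C : ℝ, 0 < C ∧ ∀ (P : Finset (Fin 4 → ℝ)) (D : ℕ), 0 < D →
      ∃ f : MvPolynomial (Fin 4) ℝ, f ≠ 0 ∧ f.totalDegree ≤ D ∧
        ∀ x : Fin 4 → ℝ, MvPolynomial.eval x f ≠ 0 →
          (Set.ncard {p : Fin 4 → ℝ | p ∈ P ∧
              p ∈ connectedComponentIn {y : Fin 4 → ℝ | MvPolynomial.eval y f ≠ 0} x} : ℝ) ≤
            C * (P.card : ℝ) / (D : ℝ) ^ 4 := by
  classical
  refine ⟨360 ^ 4, by norm_num, fun P D hD => ?_⟩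
  have hncard (f : MvPolynomial (Fin 4) ℝ) (x : Fin 4 → ℝ) :
      Set.ncard {p : Fin 4 → ℝ | p ∈ P ∧ p ∈ zeroSetCell f x} = #{p ∈ P | p ∈ zeroSetCell f x} := by
    rw [← Set.ncard_coe_finset]
    simp
  have hDpos : (0 : ℝ) < D := by exact_mod_cast hD
  obtain ⟨j, hdeg, hscale⟩ : ∃ j : ℕ, (180 * (2 ^ j - 1) : ℝ) ≤ D ∧ (D : ℝ) ≤ 360 * 2 ^ j := by
    have hne : D / 180 + 1 ≠ 0 := by omega
    have h1 := Nat.pow_log_le_self 2 hne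
    have h2 := Nat.lt_pow_succ_log_self (b := 2) (by norm_num) (D / 180 + 1)
    refine ⟨Nat.log 2 (D / 180 + 1), ?_, ?_⟩
    · have h3 : 180 * 2 ^ Nat.log 2 (D / 180 + 1) ≤ D + 180 := by omega
      have h4 : (180 * 2 ^ Nat.log 2 (D / 180 + 1) : ℝ) ≤ D + 180 := by exact_mod_cast h3
      linarith
    · have h3 : D ≤ 360 * 2 ^ Nat.log 2 (D / 180 + 1) := by
        rw [Nat.pow_succ] at h2
        omega
      exact_mod_cast h3
  obtain ⟨f, hf, hfdeg, hfcut⟩ := exists_partitioning_polynomial_dyadic P j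
  refine ⟨f, hf, by exact_mod_cast hfdeg.trans hdeg, fun x hx => ?_⟩
  rw [hncard f x]
  refine (hfcut x hx).trans ?_
  rw [div_le_div_iff₀ (by positivity) (by positivity)]
  have h4 : (D : ℝ) ^ 4 ≤ 360 ^ 4 * 16 ^ j := by
    calc (D : ℝ) ^ 4 ≤ (360 * 2 ^ j) ^ 4 := by gcongr
      _ = 360 ^ 4 * 16 ^ j := by
        rw [mul_pow, ← pow_mul, mul_comm j 4, pow_mul]; norm_num
  calc (#P : ℝ) * (D : ℝ) ^ 4 ≤ (#P : ℝ) * (360 ^ 4 * 16 ^ j) := by gcongr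
    _ = 360 ^ 4 * (#P : ℝ) * 16 ^ j := by ring
end

section
/- Fix e ≥ 1, and let F₁,…,F_ℓ be finite families of points in ℝ⁴ with ℓ ≤ C(e,4) − 1, where C(e,4) = binomial(e,4) is the dimension count (the number of monomials of degree ≤ e in 4 variables, up to the stated bound). Then there exists a nonzero polynomial P ∈ ℝ[x₁,…,x₄] of degree at most e such that for each j = 1,…,ℓ, at most |F_j|/2 points of F_j lie in {P > 0} and at most |F_j|/2 lie in {P < 0}. -/
/-- Mod 2 chains whose simplices are finite sequences of vertices. -/
abbrev SeqChain (E : Type*) := List E →₀ ZMod 2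

namespace SeqChain

open Finsupp

variable {E : Type*}

/-- The cone with apex `a` over a chain. -/
noncomputable def cons (a : E) : SeqChain E →ₗ[ZMod 2] SeqChain E :=
  lmapDomain (ZMod 2) (ZMod 2) (List.cons a)

/-- The sum of all facets of a simplex; the facet of a single vertex is the empty sequence. -/
noncomputable def facets : List E → SeqChain E
  | [] => 0
  | a :: l => single l 1 + cons a (facets l)

/-- The (augmented) boundary operator. -/
noncomputable def bdry : SeqChain E →ₗ[ZMod 2] SeqChain E :=
  linearCombination (ZMod 2) facets

@[simp] lemma cons_single (a : E) (l : List E) (r : ZMod 2) :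
    cons a (single l r) = single (a :: l) r := by
  simp [cons]

@[simp] lemma bdry_single (l : List E) : bdry (single l 1) = facets l := by
  simp [bdry]

lemma bdry_cons (a : E) (c : SeqChain E) : bdry (cons a c) = c + cons a (bdry c) := by
  suffices h : bdry ∘ₗ cons a = LinearMap.id + cons a ∘ₗ bdry from LinearMap.congr_fun h c
  ext1 l
  ext1
  simp [facets]

lemma bdry_facets (l : List E) : bdry (facets l) = 0 := by
  induction l with
  | nil => simp [facets]
  | cons a l ih =>
    simp [facets, bdry_cons, ih, ZModModule.add_self]

/-- Chains all of whose simplices lie in `S`. -/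
noncomputable abbrev chainsIn (S : Set (List E)) : Submodule (ZMod 2) (SeqChain E) :=
  supported (ZMod 2) (ZMod 2) S

lemma single_mem_chainsIn {S : Set (List E)} {l : List E} (h : l ∈ S) :
    (single l 1 : SeqChain E) ∈ chainsIn S :=
  single_mem_supported _ _ h

lemma map_mem_of_forall_single {M : Type*} [AddCommGroup M] [Module (ZMod 2) M]
    {f : SeqChain E →ₗ[ZMod 2] M} {S : Set (List E)} {Q : Submodule (ZMod 2) M}
    (h : ∀ l ∈ S, f (single l 1) ∈ Q) {c : SeqChain E} (hc : c ∈ chainsIn S) : f c ∈ Q := by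
  have hle : chainsIn S ≤ Q.comap f := by
    rw [chainsIn, supported_eq_span_single, Submodule.span_le]
    rintro _ ⟨l, hl, rfl⟩
    exact h l hl
  exact hle hc

lemma eq_of_forall_single {M : Type*} [AddCommGroup M] [Module (ZMod 2) M]
    {f g : SeqChain E →ₗ[ZMod 2] M} {S : Set (List E)}
    (h : ∀ l ∈ S, f (single l 1) = g (single l 1)) {c : SeqChain E} (hc : c ∈ chainsIn S) :
    f c = g c := by
  have : (f - g) c ∈ (⊥ : Submodule (ZMod 2) M) :=
    map_mem_of_forall_single (fun l hl => by simp [h l hl]) hc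
  simpa [sub_eq_zero] using this

lemma facets_mem (l : List E) :
    facets l ∈ chainsIn {l' | l'.Sublist l ∧ l'.length + 1 = l.length} := by
  induction l with
  | nil => simp [facets]
  | cons a l ih =>
    refine add_mem (single_mem_chainsIn (by simp)) (map_mem_of_forall_single ?_ ih)
    rintro l' ⟨h₁, h₂⟩
    rw [cons_single]
    exact single_mem_chainsIn ⟨h₁.cons_cons a, by simp [h₂]⟩

section Map

/-- The chain map induced by a map of vertices. -/
noncomputable def map (f : E → E) : SeqChain E →ₗ[ZMod 2] SeqChain E :=
  lmapDomain (ZMod 2) (ZMod 2) (List.map f)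

@[simp] lemma map_single (f : E → E) (l : List E) (r : ZMod 2) :
    map f (single l r) = single (l.map f) r := by
  simp [map]

lemma map_cons (f : E → E) (a : E) (c : SeqChain E) :
    map f (cons a c) = cons (f a) (map f c) := by
  suffices h : map f ∘ₗ cons a = cons (f a) ∘ₗ map f from LinearMap.congr_fun h c
  ext1 l
  ext1
  simp

lemma map_facets (f : E → E) (l : List E) : map f (facets l) = facets (l.map f) := by
  induction l with
  | nil => simp [facets]
  | cons a l ih => simp [facets, map_cons, ih]

lemma map_bdry (f : E → E) (c : SeqChain E) : map f (bdry c) = bdry (map f c) := by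
  suffices h : map f ∘ₗ bdry = bdry ∘ₗ map f from LinearMap.congr_fun h c
  ext1 l
  ext1
  simp [map_facets]

lemma map_neg_map_neg [InvolutiveNeg E] (c : SeqChain E) : map Neg.neg (map Neg.neg c) = c := by
  suffices h : map Neg.neg ∘ₗ map Neg.neg = (LinearMap.id : SeqChain E →ₗ[ZMod 2] SeqChain E) from
    LinearMap.congr_fun h c
  ext1 l
  ext1
  simp

end Map

section Sorting

variable (key : E → ℕ)

/-- Order the vertices of every simplex by increasing key. -/
noncomputable def sort : SeqChain E →ₗ[ZMod 2] SeqChain E :=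
  lmapDomain (ZMod 2) (ZMod 2) (List.insertionSort fun a b => key a ≤ key b)

/-- Insert a vertex into every simplex. -/
noncomputable def insertVertex (a : E) : SeqChain E →ₗ[ZMod 2] SeqChain E :=
  lmapDomain (ZMod 2) (ZMod 2) (List.orderedInsert (fun a b => key a ≤ key b) a)

@[simp] lemma sort_single (l : List E) (r : ZMod 2) :
    sort key (single l r) = single (l.insertionSort fun a b => key a ≤ key b) r := by
  simp [sort]

@[simp] lemma insertVertex_single (a : E) (l : List E) (r : ZMod 2) :
    insertVertex key a (single l r) = single (l.orderedInsert (fun a b => key a ≤ key b) a) r := by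
  simp [insertVertex]

lemma sort_cons (a : E) (c : SeqChain E) :
    sort key (cons a c) = insertVertex key a (sort key c) := by
  suffices h : sort key ∘ₗ cons a = insertVertex key a ∘ₗ sort key from LinearMap.congr_fun h c
  ext1 l
  ext1
  simp

lemma insertVertex_cons_of_le {a b : E} (h : key a ≤ key b) (c : SeqChain E) :
    insertVertex key a (cons b c) = cons a (cons b c) := by
  suffices h : insertVertex key a ∘ₗ cons b = cons a ∘ₗ cons b from LinearMap.congr_fun h c
  ext1 l
  ext1
  simp [h]

lemma insertVertex_cons_of_lt {a b : E} (h : key b < key a) (c : SeqChain E) :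
    insertVertex key a (cons b c) = cons b (insertVertex key a c) := by
  suffices h : insertVertex key a ∘ₗ cons b = cons b ∘ₗ insertVertex key a from
    LinearMap.congr_fun h c
  ext1 l
  ext1
  simp [not_le.2 h]

lemma facets_orderedInsert (a : E) {l : List E} (hl : l.Pairwise fun a b => key a ≤ key b) :
    facets (l.orderedInsert (fun a b => key a ≤ key b) a) =
      single l 1 + insertVertex key a (facets l) := by
  induction l with
  | nil => simp [facets]
  | cons b l ih =>
    obtain ⟨hb, hl⟩ := List.pairwise_cons.1 hl
    rcases le_or_gt (key a) (key b) with h | h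
    · have : l.orderedInsert (fun a b => key a ≤ key b) a = a :: l := by
        cases l with
        | nil => simp
        | cons c l => simp [h.trans (hb c (by simp))]
      simp [facets, h, insertVertex_cons_of_le, this]
    · simp [facets, not_le.2 h, insertVertex_cons_of_lt, h, ih hl]
      abel

lemma sort_facets (l : List E) :
    sort key (facets l) = facets (l.insertionSort fun a b => key a ≤ key b) := by
  induction l with
  | nil => simp [facets]
  | cons a l ih =>
    have : IsTrans E fun a b => key a ≤ key b := ⟨fun _ _ _ => le_trans⟩
    have : Std.Total (fun a b : E => key a ≤ key b) := ⟨fun _ _ => le_total _ _⟩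
    simp [facets, sort_cons, ih,
      facets_orderedInsert key a (List.pairwise_insertionSort (fun a b => key a ≤ key b) l)]

lemma sort_bdry (c : SeqChain E) : sort key (bdry c) = bdry (sort key c) := by
  suffices h : sort key ∘ₗ bdry = bdry ∘ₗ sort key from LinearMap.congr_fun h c
  ext1 l
  ext1
  simp [sort_facets]

end Sorting

section Alternating

variable (sgn : E → Bool)

/-- The indicator of the sequences whose signs alternate, starting with the sign `s`. -/
def altList : Bool → List E → ZMod 2
  | _, [] => 1
  | s, a :: l => if sgn a = s then altList (!s) l else 0

/-- The number mod 2 of simplices whose signs alternate, starting with the sign `s`. -/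
noncomputable def alt (s : Bool) : SeqChain E →ₗ[ZMod 2] ZMod 2 :=
  linearCombination (ZMod 2) (altList sgn s)

@[simp] lemma alt_single (s : Bool) (l : List E) : alt sgn s (single l 1) = altList sgn s l := by
  simp [alt]

lemma alt_cons (s : Bool) (a : E) (c : SeqChain E) :
    alt sgn s (cons a c) = if sgn a = s then alt sgn (!s) c else 0 := by
  suffices h : alt sgn s ∘ₗ cons a = if sgn a = s then alt sgn (!s) else 0 by
    have := LinearMap.congr_fun h c
    split_ifs at this ⊢ <;> simpa using this
  ext1 l
  ext1
  split_ifs <;> simp_all [altList]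

lemma alt_facets (s : Bool) (l : List E) :
    alt sgn s (facets l) = altList sgn s l + altList sgn (!s) l := by
  induction l generalizing s with
  | nil => simp [facets, altList, ZModModule.add_self]
  | cons a l ih =>
    by_cases h : sgn a = s
    · simp only [facets, map_add, alt_single, alt_cons, altList, ih, h, if_true, Bool.not_not]
      rw [add_left_comm, ZModModule.add_self]
      simp
    · have h' : sgn a = !s := by cases s <;> simp_all
      simp [facets, altList, alt_cons, h']

lemma alt_bdry (s : Bool) (c : SeqChain E) :
    alt sgn s (bdry c) = alt sgn s c + alt sgn (!s) c := by
  suffices h : alt sgn s ∘ₗ bdry = alt sgn s + alt sgn (!s) from LinearMap.congr_fun h c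
  ext1 l
  ext1
  simp [alt_facets]

lemma altList_map_neg [Neg E] {l : List E} (h : ∀ x ∈ l, sgn (-x) = !sgn x) (s : Bool) :
    altList sgn s (l.map Neg.neg) = altList sgn (!s) l := by
  induction l generalizing s with
  | nil => rfl
  | cons a l ih =>
    have := ih fun x hx => h x (List.mem_cons_of_mem _ hx)
    have ha := h a (by simp)
    cases s <;> simp [altList, ha, this]

lemma isChain_of_altList_ne_zero {key : E → ℕ} {s : Bool} {l : List E}
    (hs : altList sgn s l ≠ 0) (hl : l.Pairwise fun a b => key a ≤ key b)
    (h : ∀ x ∈ l, ∀ y ∈ l, key x = key y → sgn x = sgn y) :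
    l.IsChain fun a b => key a < key b := by
  induction l generalizing s with
  | nil => simp
  | cons a l ih =>
    obtain ⟨hal, hl⟩ := List.pairwise_cons.1 hl
    have ha : sgn a = s := by by_contra h'; simp [altList, h'] at hs
    simp only [altList, ha, if_true] at hs
    have := ih hs hl fun x hx y hy =>
      h x (List.mem_cons_of_mem _ hx) y (List.mem_cons_of_mem _ hy)
    cases l with
    | nil => simp
    | cons b l =>
      have hb : sgn b = !s := by by_contra h'; simp [altList, h'] at hs
      refine List.isChain_cons_cons.2 ⟨lt_of_le_of_ne (hal b (by simp)) fun hab => ?_, this⟩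
      have := h a (by simp) b (by simp) hab
      simp [ha, hb] at this

end Alternating

section Cutting

variable [AddCommGroup E] [Module ℝ E] (p : E →ₗ[ℝ] ℝ)

/-- All vertices of `l` lie in one closed half-space bounded by the hyperplane `p = 0`. -/
def OneSided (l : List E) : Prop := ∀ x ∈ l, ∀ y ∈ l, 0 ≤ p x * p y

variable {p} in
lemma OneSided.mono {l l' : List E} (h : OneSided p l) (hl : l' ⊆ l) : OneSided p l' :=
  fun x hx y hy => h x (hl hx) y (hl hy)

lemma oneSided_iff (l : List E) :
    OneSided p l ↔ (∀ x ∈ l, 0 ≤ p x) ∨ ∀ x ∈ l, p x ≤ 0 := by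
  constructor
  · intro h
    by_contra! h'
    obtain ⟨⟨x, hx, hx'⟩, y, hy, hy'⟩ := h'
    exact (h x hx y hy).not_gt (mul_neg_of_neg_of_pos hx' hy')
  · rintro (h | h) x hx y hy
    · exact mul_nonneg (h x hx) (h y hy)
    · exact mul_nonneg_of_nonpos_of_nonpos (h x hx) (h y hy)

lemma oneSided_of_length_le_one {l : List E} (h : l.length ≤ 1) : OneSided p l := by
  match l, h with
  | [], _ => simp [OneSided]
  | [a], _ => simp [OneSided, mul_self_nonneg]

lemma oneSided_map_neg (l : List E) : OneSided p (l.map Neg.neg) ↔ OneSided p l := by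
  simp only [OneSided, List.forall_mem_map, map_neg, neg_mul_neg]

/-- A point of the hyperplane `p = 0` in the convex cone spanned by `l`, provided that `l` has
vertices strictly on both sides. -/
noncomputable def crossing (l : List E) : E :=
  ((l ×ˢ l).find? fun z => p z.1 * p z.2 < 0).elim 0
    fun z => |p z.2| • z.1 + |p z.1| • z.2

lemma crossing_map_neg (l : List E) : crossing p (l.map Neg.neg) = -crossing p l := by
  have : l.map Neg.neg ×ˢ l.map Neg.neg = (l ×ˢ l).map (Prod.map Neg.neg Neg.neg) := by
    change List.product _ _ = List.map _ (List.product _ _)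
    simp [List.product, List.map_flatMap, List.flatMap_map, Function.comp_def]
  rw [crossing, crossing, this, List.find?_map]
  simp only [Function.comp_def, Prod.map_fst, Prod.map_snd, map_neg, neg_mul_neg]
  cases (l ×ˢ l).find? fun z => p z.1 * p z.2 < 0 <;> simp [add_comm]

lemma exists_crossing_eq {l : List E} (h : ¬ OneSided p l) :
    ∃ x ∈ l, ∃ y ∈ l, p x * p y < 0 ∧ crossing p l = |p y| • x + |p x| • y := by
  cases hz : (l ×ˢ l).find? fun z => p z.1 * p z.2 < 0 with
  | none =>
    rw [List.find?_eq_none] at hz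
    refine absurd (fun x hx y hy => ?_) h
    simpa using hz (x, y) (List.mem_product.2 ⟨hx, hy⟩)
  | some z =>
    obtain ⟨hx, hy⟩ := List.mem_product.1 (List.mem_of_find?_eq_some hz)
    exact ⟨z.1, hx, z.2, hy, by simpa using List.find?_some hz, by simp [crossing, hz]⟩

lemma apply_crossing (l : List E) : p (crossing p l) = 0 := by
  by_cases h : (l ×ˢ l).find? (fun z => p z.1 * p z.2 < 0) = none
  · simp [crossing, h]
  · obtain ⟨z, hz⟩ := Option.ne_none_iff_exists'.1 h
    have hz' : p z.1 * p z.2 < 0 := by simpa using List.find?_some hz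
    simp only [crossing, hz, Option.elim_some, map_add, map_smul, smul_eq_mul]
    rcases mul_neg_iff.1 hz' with ⟨h₁, h₂⟩ | ⟨h₁, h₂⟩
    · rw [abs_of_pos h₁, abs_of_neg h₂]; ring
    · rw [abs_of_neg h₁, abs_of_pos h₂]; ring

lemma crossing_mem {l : List E} (h : ¬ OneSided p l) (K : ConvexCone ℝ E) (hK : ∀ x ∈ l, x ∈ K) :
    crossing p l ∈ K := by
  obtain ⟨x, hx, y, hy, hxy, h⟩ := exists_crossing_eq p h
  rw [h]
  exact K.add_mem (K.smul_mem (abs_pos.2 (right_ne_zero_of_mul hxy.ne)) (hK x hx))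
    (K.smul_mem (abs_pos.2 (left_ne_zero_of_mul hxy.ne)) (hK y hy))

open Classical in
/-- Subdivide a simplex with at most `n + 1` vertices so that all pieces become one-sided. -/
noncomputable def cutList : ℕ → List E → SeqChain E
  | 0, l => single l 1
  | n + 1, l => if OneSided p l then single l 1 else
      cons (crossing p l) (linearCombination (ZMod 2) (cutList n) (facets l))

/-- Subdivide a chain whose simplices have at most `n + 1` vertices. -/
noncomputable def cut (n : ℕ) : SeqChain E →ₗ[ZMod 2] SeqChain E :=
  linearCombination (ZMod 2) (cutList p n)

@[simp] lemma cut_single (n : ℕ) (l : List E) : cut p n (single l 1) = cutList p n l := by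
  simp [cut]

lemma cutList_of_oneSided (n : ℕ) {l : List E} (h : OneSided p l) :
    cutList p n l = single l 1 := by
  cases n <;> simp [cutList, h]

lemma cutList_succ_of_not_oneSided (n : ℕ) {l : List E} (h : ¬ OneSided p l) :
    cutList p (n + 1) l = cons (crossing p l) (cut p n (facets l)) := by
  simp [cutList, h, cut]

lemma cut_zero : cut p 0 = LinearMap.id := by
  ext1 l
  ext1
  simp [cutList]

lemma bdry_cutList_of_forall {n : ℕ} (hn : ∀ l : List E, bdry (cut p n (facets l)) = 0)
    (l : List E) :
    bdry (cutList p (n + 1) l) = cut p n (facets l) := by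
  by_cases h : OneSided p l
  · rw [cutList_of_oneSided p _ h, bdry_single]
    have : cut p n (facets l) = LinearMap.id (R := ZMod 2) (facets l) :=
      eq_of_forall_single (fun l' hl' => by
        simp [cutList_of_oneSided p n (h.mono hl'.1.subset)]) (facets_mem l)
    rw [this, LinearMap.id_apply]
  · rw [cutList_succ_of_not_oneSided p n h, bdry_cons, hn, map_zero, add_zero]

lemma bdry_cut_of_forall {n : ℕ} (hn : ∀ l : List E, bdry (cut p n (facets l)) = 0)
    (c : SeqChain E) : bdry (cut p (n + 1) c) = cut p n (bdry c) := by
  suffices h : bdry ∘ₗ cut p (n + 1) = cut p n ∘ₗ bdry from LinearMap.congr_fun h c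
  ext1 l
  ext1
  simpa using bdry_cutList_of_forall p hn l

lemma bdry_cut (n : ℕ) (c : SeqChain E) : bdry (cut p (n + 1) c) = cut p n (bdry c) := by
  induction n generalizing c with
  | zero => exact bdry_cut_of_forall p (by simp [cut_zero, bdry_facets]) c
  | succ n ih => exact bdry_cut_of_forall p (by simp [ih, bdry_facets]) c

lemma cut_map_neg (n : ℕ) (c : SeqChain E) :
    cut p n (map Neg.neg c) = map Neg.neg (cut p n c) := by
  suffices h : cut p n ∘ₗ map Neg.neg = map Neg.neg ∘ₗ cut p n from LinearMap.congr_fun h c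
  ext1 l
  ext1
  simp only [LinearMap.comp_apply, lsingle_apply, map_single, cut_single]
  induction n generalizing l c with
  | zero => simp [cutList]
  | succ n ih =>
    have ih' : cut p n ∘ₗ map Neg.neg = map Neg.neg ∘ₗ cut p n := by
      ext1 l
      ext1
      simpa using ih c l
    by_cases h : OneSided p l
    · simp [cutList_of_oneSided, h, (oneSided_map_neg p l).2 h]
    · rw [cutList_succ_of_not_oneSided p n h,
        cutList_succ_of_not_oneSided p n (mt (oneSided_map_neg p l).1 h), crossing_map_neg,
        map_cons, ← map_facets]
      exact congrArg _ (LinearMap.congr_fun ih' _)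

lemma cutList_length (n : ℕ) (l : List E) :
    cutList p n l ∈ chainsIn {l' | l'.length = l.length} := by
  induction n generalizing l with
  | zero => exact single_mem_chainsIn rfl
  | succ n ih =>
    by_cases h : OneSided p l
    · rw [cutList_of_oneSided p _ h]
      exact single_mem_chainsIn rfl
    · rw [cutList_succ_of_not_oneSided p n h]
      have : cut p n (facets l) ∈ chainsIn {l' | l'.length + 1 = l.length} := by
        refine map_mem_of_forall_single (fun l' hl' => ?_) (facets_mem l)
        rw [cut_single]
        exact supported_mono (fun l'' (h : _ = _) => by simp [h, hl'.2]) (ih l')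
      refine map_mem_of_forall_single (fun l' hl' => ?_) this
      rw [cons_single]
      exact single_mem_chainsIn (by simpa using hl')

lemma cutList_cone (n : ℕ) (K : ConvexCone ℝ E) {l : List E} (hl : ∀ x ∈ l, x ∈ K) :
    cutList p n l ∈ chainsIn {l' | ∀ x ∈ l', x ∈ K} := by
  induction n generalizing l with
  | zero => exact single_mem_chainsIn hl
  | succ n ih =>
    by_cases h : OneSided p l
    · rw [cutList_of_oneSided p _ h]
      exact single_mem_chainsIn hl
    · rw [cutList_succ_of_not_oneSided p n h]
      have : cut p n (facets l) ∈ chainsIn {l' | ∀ x ∈ l', x ∈ K} := by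
        refine map_mem_of_forall_single (fun l' hl' => ?_) (facets_mem l)
        rw [cut_single]
        exact ih fun x hx => hl x (hl'.1.subset hx)
      refine map_mem_of_forall_single (fun l' hl' => ?_) this
      rw [cons_single]
      exact single_mem_chainsIn (List.forall_mem_cons.2 ⟨crossing_mem p h K hl, hl'⟩)

lemma cutList_oneSided {n : ℕ} {l : List E} (hl : l.length ≤ n + 1) :
    cutList p n l ∈ chainsIn {l' | OneSided p l'} := by
  induction n generalizing l with
  | zero => exact single_mem_chainsIn (oneSided_of_length_le_one p hl)
  | succ n ih =>
    by_cases h : OneSided p l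
    · rw [cutList_of_oneSided p _ h]
      exact single_mem_chainsIn h
    · rw [cutList_succ_of_not_oneSided p n h]
      have : cut p n (facets l) ∈ chainsIn {l' | OneSided p l'} := by
        refine map_mem_of_forall_single (fun l' hl' => ?_) (facets_mem l)
        rw [cut_single]
        exact ih (by have := hl'.2; omega)
      refine map_mem_of_forall_single (fun l' hl' => ?_) this
      rw [cons_single]
      refine single_mem_chainsIn ?_
      rw [Set.mem_ofPred_eq, oneSided_iff] at hl' ⊢
      simpa [apply_crossing] using hl'

lemma cutList_oneSided_of_oneSided (n : ℕ) {q : E →ₗ[ℝ] ℝ} {l : List E} (hl : OneSided q l) :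
    cutList p n l ∈ chainsIn {l' | OneSided q l'} := by
  rcases (oneSided_iff q l).1 hl with h | h
  · let K : ConvexCone ℝ E :=
      { carrier := {x | 0 ≤ q x}
        smul_mem' := fun c hc x hx => by simpa using mul_nonneg hc.le hx
        add_mem' := fun x hx y hy => by simpa using add_nonneg hx hy }
    exact supported_mono (fun l' hl' => (oneSided_iff q l').2 (Or.inl hl')) (cutList_cone p n K h)
  · let K : ConvexCone ℝ E :=
      { carrier := {x | q x ≤ 0}
        smul_mem' := fun c hc x hx => by simpa using mul_nonpos_of_nonneg_of_nonpos hc.le hx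
        add_mem' := fun x hx y hy => by simpa using add_nonpos hx hy }
    exact supported_mono (fun l' hl' => (oneSided_iff q l').2 (Or.inr hl')) (cutList_cone p n K h)

lemma cutList_pos (n : ℕ) {q : E →ₗ[ℝ] ℝ} {l : List E} (hl : ∀ x ∈ l, 0 < q x) :
    cutList p n l ∈ chainsIn {l' | ∀ x ∈ l', 0 < q x} := by
  let K : ConvexCone ℝ E :=
    { carrier := {x | 0 < q x}
      smul_mem' := fun c hc x hx => by simpa using mul_pos hc hx
      add_mem' := fun x hx y hy => by simpa using add_pos hx hy }
  exact cutList_cone p n K hl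

end Cutting

section Tower

variable [AddCommGroup E]

/-- A sequence of chains, one in each dimension up to `m`, such that every chain together with its
antipode bounds the next one. All simplices are required to belong to `S`. -/
structure IsAntipodalTower (m : ℕ) (S : Set (List E)) (d : ℕ → SeqChain E) : Prop where
  zero : ∃ v, d 0 = single [v] 1
  bdry_succ : ∀ n < m, bdry (d (n + 1)) = d n + map Neg.neg (d n)
  mem : ∀ n ≤ m, d n ∈ chainsIn {l | l.length = n + 1 ∧ l ∈ S}

variable {key : E → ℕ} {sgn : E → Bool}

lemma alt_sort_map_neg {S : Set (List E)} (hkey : ∀ l ∈ S, ∀ x ∈ l, key (-x) = key x)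
    (hsgn : ∀ l ∈ S, ∀ x ∈ l, sgn (-x) = !sgn x) {c : SeqChain E} (hc : c ∈ chainsIn S)
    (s : Bool) : alt sgn s (sort key (map Neg.neg c)) = alt sgn (!s) (sort key c) := by
  refine eq_of_forall_single (f := alt sgn s ∘ₗ sort key ∘ₗ map Neg.neg)
    (g := alt sgn (!s) ∘ₗ sort key) (fun l hl => ?_) hc
  simp only [LinearMap.comp_apply, map_single, sort_single, alt_single]
  rw [← List.map_insertionSort (fun a b => key a ≤ key b) (fun a b => key a ≤ key b),
    altList_map_neg]
  · exact fun x hx => hsgn l hl x ((List.mem_insertionSort _).1 hx)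
  · exact fun x hx y hy => by rw [hkey l hl x hx, hkey l hl y hy]

lemma IsAntipodalTower.alt_add_alt {m : ℕ} {S : Set (List E)} {d : ℕ → SeqChain E}
    (h : IsAntipodalTower m S d) (hkey : ∀ l ∈ S, ∀ x ∈ l, key (-x) = key x)
    (hsgn : ∀ l ∈ S, ∀ x ∈ l, sgn (-x) = !sgn x) {n : ℕ} (hn : n ≤ m) :
    alt sgn true (sort key (d n)) + alt sgn false (sort key (d n)) = 1 := by
  induction n with
  | zero =>
    obtain ⟨v, hv⟩ := h.zero
    cases hs : sgn v <;> simp [hv, altList, hs]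
  | succ n ih =>
    have hd : d n ∈ chainsIn S := supported_mono (fun l hl => hl.2) (h.mem n (by omega))
    have := alt_bdry sgn true (sort key (d (n + 1)))
    rw [← sort_bdry, h.bdry_succ n hn, map_add, map_add, alt_sort_map_neg hkey hsgn hd,
      Bool.not_true, ih (by omega)] at this
    exact this.symm

/-- A form of Tucker's lemma: a labelling of the vertices by the labels `±0, …, ±(m - 1)` has a
complementary pair inside some simplex. -/
lemma IsAntipodalTower.exists_complementary {m : ℕ} {S : Set (List E)} {d : ℕ → SeqChain E}
    (h : IsAntipodalTower m S d) (hkey : ∀ l ∈ S, ∀ x ∈ l, key (-x) = key x)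
    (hsgn : ∀ l ∈ S, ∀ x ∈ l, sgn (-x) = !sgn x) (hlt : ∀ l ∈ S, ∀ x ∈ l, key x < m) :
    ∃ l ∈ S, ∃ x ∈ l, ∃ y ∈ l, key x = key y ∧ sgn x ≠ sgn y := by
  by_contra! hcon
  suffices H : ∀ s, alt sgn s (sort key (d m)) = 0 by
    simpa [H] using h.alt_add_alt hkey hsgn le_rfl
  intro s
  have key_trans : IsTrans E fun a b => key a ≤ key b := ⟨fun _ _ _ => le_trans⟩
  have key_total : Std.Total (fun a b : E => key a ≤ key b) := ⟨fun _ _ => le_total _ _⟩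
  have lt_trans : IsTrans E fun a b => key a < key b := ⟨fun _ _ _ => _root_.lt_trans⟩
  refine eq_of_forall_single (f := alt sgn s ∘ₗ sort key) (g := 0) (fun l hl => ?_) (h.mem m le_rfl)
  obtain ⟨hlen, hl⟩ := hl
  simp only [LinearMap.comp_apply, sort_single, alt_single, LinearMap.zero_apply]
  by_contra hne
  have hchain := isChain_of_altList_ne_zero sgn hne (List.pairwise_insertionSort _ l)
    fun x hx y hy => hcon l hl x ((List.mem_insertionSort _).1 hx) y
      ((List.mem_insertionSort _).1 hy)
  set l' := l.insertionSort fun a b => key a ≤ key b with hl'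
  have hnodup : (l'.map key).Nodup :=
    List.pairwise_map.2 ((List.isChain_iff_pairwise.1 hchain).imp ne_of_lt)
  have hsub : (l'.map key).toFinset ⊆ Finset.range m := by
    intro k hk
    obtain ⟨x, hx, rfl⟩ := List.mem_map.1 (List.mem_toFinset.1 hk)
    exact Finset.mem_range.2 (hlt l hl x ((List.mem_insertionSort _).1 hx))
  have := Finset.card_le_card hsub
  rw [List.toFinset_card_of_nodup hnodup, List.length_map, hl', List.length_insertionSort,
    Finset.card_range] at this
  omega

variable [Module ℝ E]

lemma IsAntipodalTower.cut {m : ℕ} {S S' : Set (List E)} {d : ℕ → SeqChain E}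
    (h : IsAntipodalTower m S d) (p : E →ₗ[ℝ] ℝ)
    (hS : ∀ n, ∀ l ∈ S, l.length ≤ n + 1 → cutList p n l ∈ chainsIn S') :
    IsAntipodalTower m S' fun n => cut p (n + 1) (d n) where
  zero := by
    obtain ⟨v, hv⟩ := h.zero
    exact ⟨v, by simp [hv, cutList_of_oneSided p 1 (oneSided_of_length_le_one p (l := [v]) le_rfl)]⟩
  bdry_succ n hn := by
    rw [bdry_cut, h.bdry_succ n hn, map_add, cut_map_neg]
  mem n hn := by
    refine map_mem_of_forall_single (fun l hl => ?_) (h.mem n hn)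
    rw [cut_single]
    have h₁ := cutList_length p (n + 1) l
    rw [hl.1] at h₁
    have h₂ := hS (n + 1) l hl.2 (hl.1.trans_le (Nat.le_succ _))
    exact (mem_supported _ _).2 fun _ hmem =>
      ⟨(mem_supported _ _).1 h₁ hmem, (mem_supported _ _).1 h₂ hmem⟩

/-- The sequences contained in an open half-space and on one side of every hyperplane of `T`. -/
def cellular (T : Set (E →ₗ[ℝ] ℝ)) : Set (List E) :=
  {l | (∃ q : E →ₗ[ℝ] ℝ, ∀ x ∈ l, 0 < q x) ∧ ∀ p ∈ T, OneSided p l}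

lemma IsAntipodalTower.exists_cellular {m : ℕ} {d : ℕ → SeqChain E}
    (h : IsAntipodalTower m (cellular ∅) d) {T : Set (E →ₗ[ℝ] ℝ)} (hT : T.Finite) :
    ∃ d', IsAntipodalTower m (cellular T) d' := by
  induction T, hT using Set.Finite.induction_on with
  | empty => exact ⟨d, h⟩
  | @insert p T _ _ ih =>
    obtain ⟨d', hd'⟩ := ih
    refine ⟨_, hd'.cut p fun n l hl hlen => ?_⟩
    obtain ⟨⟨q, hq⟩, hl⟩ := hl
    refine (mem_supported _ _).2 fun l' hl' => ⟨⟨q, ?_⟩, ?_⟩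
    · exact (mem_supported _ _).1 (cutList_pos _ n hq) hl'
    · rintro r (rfl | hr)
      · exact (mem_supported _ _).1 (cutList_oneSided _ hlen) hl'
      · exact (mem_supported _ _).1 (cutList_oneSided_of_oneSided _ n (hl r hr)) hl'

end Tower

section CrossPolytope

/-- The `n`-th standard unit vector, or zero if there is none. -/
def unitVector (m n : ℕ) : Fin m → ℝ := fun i => if (i : ℕ) = n then 1 else 0

/-- A hemisphere of the boundary of the cross-polytope in `n + 1` dimensions. -/
noncomputable def hemisphere (m : ℕ) : ℕ → SeqChain (Fin m → ℝ)
  | 0 => single [unitVector m 0] 1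
  | n + 1 => cons (unitVector m (n + 1)) (hemisphere m n + map Neg.neg (hemisphere m n))

lemma bdry_hemisphere_succ (m n : ℕ) :
    bdry (hemisphere m (n + 1)) = hemisphere m n + map Neg.neg (hemisphere m n) := by
  have h : bdry (hemisphere m n) + map Neg.neg (bdry (hemisphere m n)) = 0 := by
    cases n with
    | zero => simp [hemisphere, facets, ZModModule.add_self]
    | succ n =>
      rw [bdry_hemisphere_succ m n, map_add, map_neg_map_neg, add_comm (map _ _),
        ZModModule.add_self]
  rw [hemisphere, bdry_cons, map_add, ← map_bdry, h, map_zero, add_zero]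

lemma hemisphere_mem (m n : ℕ) (hn : n < m) :
    hemisphere m n ∈ chainsIn {l | l.length = n + 1 ∧ ∃ w : Fin m → ℝ,
      ∀ x ∈ l, 0 < w ⬝ᵥ x ∧ ∀ i : Fin m, n < i → x i = 0} := by
  induction n with
  | zero =>
    refine single_mem_chainsIn ⟨rfl, 1, fun x hx => ?_⟩
    rw [List.mem_singleton.1 hx]
    have hu : unitVector m 0 = Pi.single ⟨0, hn⟩ 1 := by
      ext i; simp [unitVector, Pi.single_apply, Fin.ext_iff]
    refine ⟨by simp [hu], fun i hi => by simp [unitVector, hi.ne']⟩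
  | succ n ih =>
    have ih := ih (by omega)
    have hneg : map Neg.neg (hemisphere m n) ∈ chainsIn {l | l.length = n + 1 ∧
        ∃ w : Fin m → ℝ, ∀ x ∈ l, 0 < w ⬝ᵥ x ∧ ∀ i : Fin m, n < i → x i = 0} := by
      refine map_mem_of_forall_single ?_ ih
      rintro l ⟨hlen, w, hw⟩
      rw [map_single]
      refine single_mem_chainsIn ⟨by simpa using hlen, -w, ?_⟩
      simpa only [List.forall_mem_map, neg_dotProduct_neg, Pi.neg_apply, neg_eq_zero] using hw
    refine map_mem_of_forall_single ?_ (add_mem ih hneg)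
    rintro l ⟨hlen, w, hw⟩
    rw [cons_single]
    have hu : unitVector m (n + 1) = Pi.single ⟨n + 1, hn⟩ 1 := by
      ext i; simp [unitVector, Pi.single_apply, Fin.ext_iff]
    refine single_mem_chainsIn ⟨by simpa using hlen, Function.update w ⟨n + 1, hn⟩ 1,
      List.forall_mem_cons.2 ⟨⟨by simp [hu], fun i hi => by simp [unitVector, hi.ne']⟩,
      fun x hx => ⟨?_, fun i hi => (hw x hx).2 i (by omega)⟩⟩⟩
    have hx0 : x ⟨n + 1, hn⟩ = 0 := (hw x hx).2 _ (Nat.lt_succ_self n)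
    convert (hw x hx).1 using 1
    refine Finset.sum_congr rfl fun i _ => ?_
    by_cases hi : i = ⟨n + 1, hn⟩
    · simp [hi, hx0]
    · simp [hi]

lemma isAntipodalTower_hemisphere (m : ℕ) :
    IsAntipodalTower m (cellular ∅) (hemisphere (m + 1)) where
  zero := ⟨_, rfl⟩
  bdry_succ n _ := bdry_hemisphere_succ _ n
  mem n hn := by
    refine supported_mono ?_ (hemisphere_mem (m + 1) n (by omega))
    rintro l ⟨hlen, w, hw⟩
    exact ⟨hlen, ⟨dotProductBilin ℝ ℝ w, fun x hx => (hw x hx).1⟩, by simp⟩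

end CrossPolytope
end SeqChain

open SeqChain in
/-- The discrete ham sandwich theorem for linear functionals: `m` finite families of linear
functionals on an `m + 1`-dimensional space can be bisected simultaneously by a nonzero vector. -/
theorem exists_ne_zero_bisecting {α : Type*} (m : ℕ) (φ : α → (Fin (m + 1) → ℝ) →ₗ[ℝ] ℝ)
    (F : ℕ → Finset α) :
    ∃ x ≠ 0, ∀ j < m, 2 * {a ∈ F j | 0 < φ a x}.card ≤ (F j).card ∧
      2 * {a ∈ F j | φ a x < 0}.card ≤ (F j).card := by
  classical
  by_contra! hcon
  let pos (j : ℕ) (x : Fin (m + 1) → ℝ) : Finset α := {a ∈ F j | 0 < φ a x}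
  have pos_neg (j : ℕ) (x) : pos j (-x) = {a ∈ F j | φ a x < 0} := by simp [pos]
  let bad (x : Fin (m + 1) → ℝ) : Set ℕ :=
    {j | j < m ∧ ((F j).card < 2 * (pos j x).card ∨ (F j).card < 2 * (pos j (-x)).card)}
  have bad_neg (x) : bad (-x) = bad x := by simp [bad, or_comm]
  let key (x : Fin (m + 1) → ℝ) : ℕ := sInf (bad x)
  let sgn (x : Fin (m + 1) → ℝ) : Bool := (F (key x)).card < 2 * (pos (key x) x).card
  have key_neg (x) : key (-x) = key x := by simp only [key, bad_neg]
  have key_mem {x} (hx : x ≠ 0) : key x ∈ bad x := by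
    refine Nat.sInf_mem ?_
    obtain ⟨j, hj, h⟩ := hcon x hx
    refine ⟨j, hj, ?_⟩
    rw [pos_neg]
    exact or_iff_not_imp_left.2 fun h' => h (not_lt.1 h')
  have card_add (j x) : (pos j x).card + (pos j (-x)).card ≤ (F j).card := by
    rw [pos_neg, ← Finset.card_union_of_disjoint
      (Finset.disjoint_filter.2 fun a _ h h' => h.not_gt h')]
    exact Finset.card_le_card (by simp [Finset.union_subset_iff])
  have sgn_neg {x} (hx : x ≠ 0) : sgn (-x) = !sgn x := by
    have h₁ := (key_mem hx).2
    have h₂ := card_add (key x) x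
    simp only [sgn, key_neg, ← decide_not, decide_eq_decide]
    omega
  let T : Set ((Fin (m + 1) → ℝ) →ₗ[ℝ] ℝ) := ⋃ j < m, φ '' F j
  have hT : T.Finite :=
    (Set.finite_lt_nat m).biUnion fun j _ => (F j).finite_toSet.image φ
  obtain ⟨d, hd⟩ := (isAntipodalTower_hemisphere m).exists_cellular hT
  have ne_zero : ∀ l ∈ cellular T, ∀ x ∈ l, x ≠ 0 := by
    rintro l ⟨⟨q, hq⟩, -⟩ x hx rfl
    simpa using hq 0 hx
  obtain ⟨l, hl, x, hx, y, hy, hxy, hs⟩ := hd.exists_complementary (key := key) (sgn := sgn)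
    (fun _ _ x _ => key_neg x) (fun l hl x hx => sgn_neg (ne_zero l hl x hx))
    (fun l hl x hx => (key_mem (ne_zero l hl x hx)).1)
  have hfalse {x y} (hx : x ∈ l) (hy : y ∈ l) (hxy : key x = key y) (h₁ : sgn x = true)
      (h₂ : sgn y = false) : False := by
    have hy' := key_mem (ne_zero l hl y hy)
    have h₁ : (F (key x)).card < 2 * (pos (key x) x).card := by simpa [sgn] using h₁
    have h₂ : ¬ (F (key y)).card < 2 * (pos (key y) y).card := by simpa [sgn] using h₂
    have h₃ := hy'.2.resolve_left h₂
    rw [hxy] at h₁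
    obtain ⟨a, ha⟩ : (pos (key y) x ∩ pos (key y) (-y)).Nonempty := by
      by_contra h
      rw [Finset.not_nonempty_iff_eq_empty, ← Finset.disjoint_iff_inter_eq_empty] at h
      have hle : (pos (key y) x ∪ pos (key y) (-y)).card ≤ (F (key y)).card :=
        Finset.card_le_card (by simp [pos, Finset.union_subset_iff])
      rw [Finset.card_union_of_disjoint h] at hle
      omega
    rw [pos_neg, Finset.mem_inter, Finset.mem_filter, Finset.mem_filter] at ha
    exact (hl.2 (φ a) (Set.mem_biUnion hy'.1 ⟨a, ha.1.1, rfl⟩) x hx y hy).not_gt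
      (mul_neg_of_pos_of_neg ha.1.2 ha.2.2)
  cases h₁ : sgn x <;> cases h₂ : sgn y
  · simp [h₁, h₂] at hs
  · exact hfalse hy hx hxy.symm h₂ h₁
  · exact hfalse hx hy hxy h₁ h₂
  · simp [h₁, h₂] at hs

open Finset in
lemma exists_injective_exponents {d e n : ℕ} (h : n ≤ (e + d).choose d) :
    ∃ s : Fin n → Fin d →₀ ℕ, Function.Injective s ∧ ∀ i, (s i).degree ≤ e := by
  let A := (univ : Finset (Fin (d + 1))).finsuppAntidiag e
  have hA : n ≤ A.card := by
    rw [card_finsuppAntidiag_nat_eq_choose, card_fin, show d + 1 + e - 1 = e + d by omega]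
    rwa [Nat.choose_symm_add]
  let f : Fin n → A := fun i => A.equivFin.symm (Fin.castLE hA i)
  have hf (i : Fin n) : (f i : Fin (d + 1) →₀ ℕ) 0 + (f i : Fin (d + 1) →₀ ℕ).tail.degree = e := by
    have := (mem_finsuppAntidiag.1 (f i).2).1
    rw [Fin.sum_univ_succ] at this
    simpa [Finsupp.degree_eq_sum, Finsupp.tail_apply] using this
  refine ⟨fun i => (f i : Fin (d + 1) →₀ ℕ).tail, fun i j hij => ?_, fun i => ?_⟩
  · replace hij : (f i : Fin (d + 1) →₀ ℕ).tail = (f j : Fin (d + 1) →₀ ℕ).tail := hij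
    have h0 : (f i : Fin (d + 1) →₀ ℕ) 0 = (f j : Fin (d + 1) →₀ ℕ) 0 := by
      have hi := hf i
      have hj := hf j
      rw [hij] at hi
      omega
    have : f i = f j := by
      refine Subtype.ext ?_
      rw [← Finsupp.cons_tail (f i : Fin (d + 1) →₀ ℕ),
        ← Finsupp.cons_tail (f j : Fin (d + 1) →₀ ℕ), h0, hij]
    simpa [f] using this
  · have := hf i
    simp only
    omega

/-- The discrete polynomial ham sandwich theorem in `ℝ^d`. -/
theorem exists_bisecting_mvPolynomial {d e m : ℕ} (h : m + 1 ≤ (e + d).choose d)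
    (F : ℕ → Finset (Fin d → ℝ)) :
    ∃ f : MvPolynomial (Fin d) ℝ, f ≠ 0 ∧ f.totalDegree ≤ e ∧
      ∀ j < m, 2 * {a ∈ F j | 0 < MvPolynomial.eval a f}.card ≤ (F j).card ∧
        2 * {a ∈ F j | MvPolynomial.eval a f < 0}.card ≤ (F j).card := by
  obtain ⟨s, hs, hdeg⟩ := exists_injective_exponents h
  let L : (Fin (m + 1) → ℝ) →ₗ[ℝ] MvPolynomial (Fin d) ℝ :=
    Fintype.linearCombination ℝ fun i => MvPolynomial.monomial (s i) 1
  obtain ⟨x, hx, hbis⟩ := exists_ne_zero_bisecting m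
    (fun a => (MvPolynomial.aeval a).toLinearMap ∘ₗ L) F
  have hL : L x = ∑ i, MvPolynomial.monomial (s i) (x i) := by
    simp [L, Fintype.linearCombination_apply, MvPolynomial.smul_monomial]
  refine ⟨L x, fun h0 => hx (funext fun i => ?_), ?_, hbis⟩
  · have := congrArg (MvPolynomial.coeff (s i)) h0
    simpa [hL, MvPolynomial.coeff_sum, MvPolynomial.coeff_monomial, hs.eq_iff] using this
  · rw [hL]
    refine MvPolynomial.totalDegree_finsetSum_le fun i _ =>
      (MvPolynomial.totalDegree_monomial_le _ _).trans ?_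
    exact hdeg i

/-- The discrete polynomial ham sandwich theorem (Guth–Katz): given at most
`binomial(e,4) - 1` finite families of points in `ℝ⁴`, there is a nonzero
polynomial of degree at most `e` simultaneously bisecting all of them: each
open side of its zero set contains at most half of each family. -/
theorem stmt_13 (e ℓ : ℕ) (he : 1 ≤ e) (hℓ : ℓ ≤ Nat.choose e 4 - 1)
    (F : Fin ℓ → Finset (Fin 4 → ℝ)) :
    ∃ f : MvPolynomial (Fin 4) ℝ, f ≠ 0 ∧ f.totalDegree ≤ e ∧
      ∀ j : Fin ℓ,
        (Set.ncard {p : Fin 4 → ℝ | p ∈ F j ∧ 0 < MvPolynomial.eval p f} : ℝ) ≤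
          ((F j).card : ℝ) / 2 ∧
        (Set.ncard {p : Fin 4 → ℝ | p ∈ F j ∧ MvPolynomial.eval p f < 0} : ℝ) ≤
          ((F j).card : ℝ) / 2 := by
  have hm : ℓ + 1 ≤ (e + 4).choose 4 := by
    have h₁ : e.choose 4 ≤ (e + 4).choose 4 := Nat.choose_le_choose 4 (by omega)
    have h₂ : 0 < (e + 4).choose 4 := Nat.choose_pos (by omega)
    omega
  obtain ⟨f, hf, hdeg, hbis⟩ :=
    exists_bisecting_mvPolynomial hm fun k => if h : k < ℓ then F ⟨k, h⟩ else ∅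
  refine ⟨f, hf, hdeg, fun j => ?_⟩
  have hj := hbis j j.2
  simp only [j.2, dif_pos] at hj
  have hcast {k n : ℕ} (h : 2 * k ≤ n) : (k : ℝ) ≤ n / 2 := by
    rw [le_div_iff₀ two_pos, mul_comm]
    exact_mod_cast h
  rw [← Finset.coe_filter, ← Finset.coe_filter, Set.ncard_coe_finset, Set.ncard_coe_finset]
  exact ⟨hcast hj.1, hcast hj.2⟩
end
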